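/- arXiv:1803.09003 — 4 statements merged into one kernel-verified Lean document; each statement's English description precedes it below -/
import Mathlib

section
/- If P ∈ {0,1}^{k×ℓ} is a pattern with at most two nonempty rows (a row is nonempty if it contains at least one 1-entry), then P is row-bounding; in fact for every 1-entry e of P, every row of every matrix avoiding P as interval minor contains at most ℓ² 0-runs critical for e. -/
/-!
Common framework: binary matrices, interval minors, criticality, 0-runs,
row/column complexity, embeddings and related notions, following
Jelínek–Kučera, "On the structure of matrices avoiding interval-minor
patterns". All indices are 0-based.
-/

/-- A binary matrix: dimensions `m × n`, with entries given by a total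
function (entries outside the range `[0,m) × [0,n)` are irrelevant:
all definitions below only inspect in-range entries). -/
structure BMat where
  m : ℕ
  n : ℕ
  entry : ℕ → ℕ → Bool

namespace BMat

/-- The support of a binary matrix: its set of (in-range) 1-entries. -/
def supp (M : BMat) : Set (ℕ × ℕ) :=
  {p | p.1 < M.m ∧ p.2 < M.n ∧ M.entry p.1 p.2 = true}

/-- `M'` is obtained from `M` by contracting two adjacent rows `r`, `r+1`. -/
def RowCon (M M' : BMat) : Prop :=
  ∃ r, r + 1 < M.m ∧ M'.m + 1 = M.m ∧ M'.n = M.n ∧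
    ∀ i j, i < M'.m → j < M'.n →
      M'.entry i j =
        if i < r then M.entry i j
        else if i = r then (M.entry r j || M.entry (r + 1) j)
        else M.entry (i + 1) j

/-- `M'` is obtained from `M` by contracting two adjacent columns `c`, `c+1`. -/
def ColCon (M M' : BMat) : Prop :=
  ∃ c, c + 1 < M.n ∧ M'.n + 1 = M.n ∧ M'.m = M.m ∧
    ∀ i j, i < M'.m → j < M'.n →
      M'.entry i j =
        if j < c then M.entry i j
        else if j = c then (M.entry i c || M.entry i (c + 1))
        else M.entry i (j + 1)

/-- One contraction step (of a row or of a column). -/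
def Con (M M' : BMat) : Prop := RowCon M M' ∨ ColCon M M'

/-- `P` is an interval minor of `M`: `M` can be transformed by a sequence of
row and column contractions into a matrix of the same dimensions as `P`
dominating `P`. -/
def IntervalMinor (P M : BMat) : Prop :=
  ∃ M', Relation.ReflTransGen Con M M' ∧ M'.m = P.m ∧ M'.n = P.n ∧
    ∀ i j, i < P.m → j < P.n → P.entry i j = true → M'.entry i j = true

/-- `M` avoids `P` as an interval minor. -/
def Avoids (P M : BMat) : Prop := ¬ IntervalMinor P M

/-- The class of all matrices avoiding `P` as an interval minor. -/
def Av (P : BMat) : Set BMat := {M | Avoids P M}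

/-- The class of all matrices avoiding every pattern of `F` as an interval
minor. -/
def AvF (F : Set BMat) : Set BMat := {M | ∀ P ∈ F, Avoids P M}

/-- The matrix obtained from `M` by changing the entry at position `(i, j)`
into a 1-entry. -/
def setOne (M : BMat) (i j : ℕ) : BMat :=
  ⟨M.m, M.n, fun a b => if a = i ∧ b = j then true else M.entry a b⟩

/-- `M` is critical for the class `C`: it lies in `C`, but changing any
single 0-entry of `M` into a 1-entry leaves `C`. -/
def CriticalFor (C : Set BMat) (M : BMat) : Prop :=
  M ∈ C ∧ ∀ i j, i < M.m → j < M.n → M.entry i j = false → setOne M i j ∉ C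

/-- The number of horizontal 0-runs in row `r` of `M`, counted via their
starting columns. -/
noncomputable def rowRunCount (M : BMat) (r : ℕ) : ℕ :=
  Set.ncard {j | j < M.n ∧ M.entry r j = false ∧ (j = 0 ∨ M.entry r (j - 1) = true)}

/-- The number of vertical 0-runs in column `c` of `M`. -/
noncomputable def colRunCount (M : BMat) (c : ℕ) : ℕ :=
  Set.ncard {i | i < M.m ∧ M.entry i c = false ∧ (i = 0 ∨ M.entry (i - 1) c = true)}

/-- A class is row-bounded if there is a uniform bound on the number of
0-runs in any row of any matrix that is critical for the class. -/
def RowBounded (C : Set BMat) : Prop :=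
  ∃ K, ∀ M, CriticalFor C M → ∀ r, r < M.m → rowRunCount M r ≤ K

/-- A class is column-bounded if there is a uniform bound on the number of
0-runs in any column of any matrix that is critical for the class. -/
def ColBounded (C : Set BMat) : Prop :=
  ∃ K, ∀ M, CriticalFor C M → ∀ c, c < M.n → colRunCount M c ≤ K

/-- A class is bounded if it is both row-bounded and column-bounded. -/
def Bounded (C : Set BMat) : Prop := RowBounded C ∧ ColBounded C

/-- The pattern `Q₁`, with support `{(1,2),(2,1),(3,3)}` (1-based). -/
def Q1 : BMat :=
  ⟨3, 3, fun i j => (i == 0 && j == 1) || (i == 1 && j == 0) || (i == 2 && j == 2)⟩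

/-- The pattern `Q₂`, with support `{(1,2),(2,3),(3,1)}` (1-based). -/
def Q2 : BMat :=
  ⟨3, 3, fun i j => (i == 0 && j == 1) || (i == 1 && j == 2) || (i == 2 && j == 0)⟩

/-- The pattern `Q₃`, with support `{(1,1),(2,3),(3,2)}` (1-based). -/
def Q3 : BMat :=
  ⟨3, 3, fun i j => (i == 0 && j == 0) || (i == 1 && j == 2) || (i == 2 && j == 1)⟩

/-- The pattern `Q₄`, with support `{(1,3),(2,1),(3,2)}` (1-based). -/
def Q4 : BMat :=
  ⟨3, 3, fun i j => (i == 0 && j == 2) || (i == 1 && j == 0) || (i == 2 && j == 1)⟩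

/-- The diagonal pattern `D_k`, with support `{(i,i) : i ∈ [k]}`. -/
def D (k : ℕ) : BMat := ⟨k, k, fun i j => i == j⟩

/-- The antidiagonal pattern `D̄_k`, with support `{(i, k+1-i) : i ∈ [k]}`
(1-based). -/
def Dbar (k : ℕ) : BMat := ⟨k, k, fun i j => i + j + 1 == k⟩

/-- An embedding of `P` into `M`: 1-entries go to 1-entries, and the map is
strictly monotone in rows and in columns. -/
def IsEmbedding (P M : BMat) (φ : ℕ → ℕ → ℕ × ℕ) : Prop :=
  (∀ i j, i < P.m → j < P.n → (φ i j).1 < M.m ∧ (φ i j).2 < M.n) ∧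
  (∀ i j, i < P.m → j < P.n → P.entry i j = true →
      M.entry (φ i j).1 (φ i j).2 = true) ∧
  (∀ i₁ j₁ i₂ j₂, i₁ < P.m → j₁ < P.n → i₂ < P.m → j₂ < P.n →
      (i₁ < i₂ → (φ i₁ j₁).1 < (φ i₂ j₂).1) ∧
      (j₁ < j₂ → (φ i₁ j₁).2 < (φ i₂ j₂).2))

/-- A partition of `M` containing `P` (via row indices `r 0 < ⋯ < r P.m ≤ M.m`
and column indices `c 0 < ⋯ < c P.n ≤ M.n`). -/
def PartitionContains (M P : BMat) : Prop :=
  ∃ r c : ℕ → ℕ,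
    (∀ i, i < P.m → r i < r (i + 1)) ∧ (∀ j, j < P.n → c j < c (j + 1)) ∧
    r P.m ≤ M.m ∧ c P.n ≤ M.n ∧
    ∀ i j, i < P.m → j < P.n → P.entry i j = true →
      ∃ a b, r i ≤ a ∧ a < r (i + 1) ∧ c j ≤ b ∧ b < c (j + 1) ∧
        M.entry a b = true

/-- A partial embedding of `P` into `M`, defined on a nonempty set `S` of
entries of `P`. -/
def IsPartialEmbedding (P M : BMat) (S : Set (ℕ × ℕ)) (ψ : ℕ × ℕ → ℕ × ℕ) : Prop :=
  S.Nonempty ∧ (∀ e ∈ S, e.1 < P.m ∧ e.2 < P.n) ∧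
  (∀ i j, i < P.m → j < P.n → P.entry i j = true →
      (i, j) ∈ S ∧ M.entry (ψ (i, j)).1 (ψ (i, j)).2 = true) ∧
  (∀ e ∈ S, (ψ e).1 < M.m ∧ (ψ e).2 < M.n ∧
      e.1 ≤ (ψ e).1 ∧ e.2 ≤ (ψ e).2 ∧
      P.m - 1 - e.1 ≤ M.m - 1 - (ψ e).1 ∧ P.n - 1 - e.2 ≤ M.n - 1 - (ψ e).2) ∧
  (∀ e₁ ∈ S, ∀ e₂ ∈ S,
      (e₁.1 < e₂.1 → e₂.1 - e₁.1 ≤ (ψ e₂).1 - (ψ e₁).1) ∧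
      (e₁.2 < e₂.2 → e₂.2 - e₁.2 ≤ (ψ e₂).2 - (ψ e₁).2))

/-- A horizontal 0-run of `M` in row `r`, occupying exactly columns
`c₁, …, c₂`. -/
def ZeroRun (M : BMat) (r c₁ c₂ : ℕ) : Prop :=
  r < M.m ∧ c₁ ≤ c₂ ∧ c₂ < M.n ∧
  (∀ j, c₁ ≤ j → j ≤ c₂ → M.entry r j = false) ∧
  (c₁ = 0 ∨ M.entry r (c₁ - 1) = true) ∧
  (c₂ + 1 = M.n ∨ M.entry r (c₂ + 1) = true)

/-- The 0-entry `f` of `M` is critical for the 1-entry `e` of `P`: some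
embedding of `P` into `M △ f` maps `e` to `f`. -/
def CritEntry (P : BMat) (e : ℕ × ℕ) (M : BMat) (f : ℕ × ℕ) : Prop :=
  f.1 < M.m ∧ f.2 < M.n ∧ M.entry f.1 f.2 = false ∧
  ∃ φ, IsEmbedding P (setOne M f.1 f.2) φ ∧ φ e.1 e.2 = f

/-- The number of horizontal 0-runs in row `r` of `M` that are critical for
the 1-entry `e` of `P` (counted via their starting columns). -/
noncomputable def critRunCount (P : BMat) (e : ℕ × ℕ) (M : BMat) (r : ℕ) : ℕ :=
  Set.ncard {c₁ | ∃ c₂, ZeroRun M r c₁ c₂ ∧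
    ∃ c, c₁ ≤ c ∧ c ≤ c₂ ∧ CritEntry P e M (r, c)}

/-- The 1-entry `e` of `P` is row-bounding: every row of every `P`-avoiding
matrix contains a bounded number of 0-runs critical for `e`. -/
def EntryRowBounding (P : BMat) (e : ℕ × ℕ) : Prop :=
  ∃ K, ∀ M, Avoids P M → ∀ r, critRunCount P e M r ≤ K

/-- An increasing walk from `e` to `e'`: a sequence of positions, each step
moving one column to the right or one row up, with `W` its set of
positions. -/
def IsIncreasingWalk (W : Set (ℕ × ℕ)) (e e' : ℕ × ℕ) : Prop :=
  ∃ (t : ℕ) (f : ℕ → ℕ × ℕ), f 0 = e ∧ f t = e' ∧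
    W = {x | ∃ i, i ≤ t ∧ f i = x} ∧
    ∀ i, i < t →
      ((f (i + 1)).1 = (f i).1 ∧ (f (i + 1)).2 = (f i).2 + 1) ∨
      ((f (i + 1)).1 + 1 = (f i).1 ∧ (f (i + 1)).2 = (f i).2)

/-- All 1-entries of `P` can be covered by at most `k` lines
(rows or columns). -/
def CoveredByLines (P : BMat) (k : ℕ) : Prop :=
  ∃ (R C : Finset ℕ), R.card + C.card ≤ k ∧
    ∀ i j, i < P.m → j < P.n → P.entry i j = true → i ∈ R ∨ j ∈ C

/-- Clockwise rotation by 90 degrees. -/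
def rot90 (P : BMat) : BMat := ⟨P.n, P.m, fun i j => P.entry (P.m - 1 - j) i⟩

/-- Rotation by 180 degrees. -/
def rot180 (P : BMat) : BMat :=
  ⟨P.m, P.n, fun i j => P.entry (P.m - 1 - i) (P.n - 1 - j)⟩

/-- Clockwise rotation by 270 degrees. -/
def rot270 (P : BMat) : BMat := ⟨P.n, P.m, fun i j => P.entry j (P.n - 1 - i)⟩

/-- Reflection turning the matrix upside down (reversing the rows). -/
def reflRows (P : BMat) : BMat := ⟨P.m, P.n, fun i j => P.entry (P.m - 1 - i) j⟩

/-- Reflection reversing the columns. -/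
def reflCols (P : BMat) : BMat := ⟨P.m, P.n, fun i j => P.entry i (P.n - 1 - j)⟩

/-- Reflection along the main diagonal (transposition). -/
def transposeB (P : BMat) : BMat := ⟨P.n, P.m, fun i j => P.entry j i⟩

/-- Reflection along the antidiagonal. -/
def antitransposeB (P : BMat) : BMat :=
  ⟨P.n, P.m, fun i j => P.entry (P.m - 1 - j) (P.n - 1 - i)⟩

/-- Type 1 pattern of Lemma `lem-2types`: rows `r < r' < r''`, columns
`c < c'`, with `supp ⊆ ({r'} × [c,c']) ∪ {(r,c),(r'',c),(r,c'),(r'',c')}`. -/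
def TypeOne (P₀ : BMat) : Prop :=
  ∃ r r' r'' c c', r < r' ∧ r' < r'' ∧ r'' < P₀.m ∧ c < c' ∧ c' < P₀.n ∧
    ∀ i j, i < P₀.m → j < P₀.n → P₀.entry i j = true →
      (i = r' ∧ c ≤ j ∧ j ≤ c') ∨ ((i = r ∨ i = r'') ∧ (j = c ∨ j = c'))

/-- Type 2 pattern of Lemma `lem-2types`: rows `r < r'`, columns `c < c'`,
with `supp ⊆ ({r} × [c,c']) ∪ ({r'} × [1,c]) ∪ ([1,r] × {c'}) ∪ {(r',c')}`. -/
def TypeTwo (P₀ : BMat) : Prop :=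
  ∃ r r' c c', r < r' ∧ r' < P₀.m ∧ c < c' ∧ c' < P₀.n ∧
    ∀ i j, i < P₀.m → j < P₀.n → P₀.entry i j = true →
      (i = r ∧ c ≤ j ∧ j ≤ c') ∨ (i = r' ∧ j ≤ c) ∨ (i ≤ r ∧ j = c') ∨
      (i = r' ∧ j = c')

/-- A minor-closed class of binary matrices. -/
def MinorClosed (C : Set BMat) : Prop :=
  ∀ M ∈ C, ∀ P, IntervalMinor P M → P ∈ C

/-- The 4×3 pattern with support `{(1,2),(2,1),(3,2),(4,3)}` (1-based), from
Proposition `pro-counter`. -/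
def P18 : BMat :=
  ⟨4, 3, fun i j => (i == 0 && j == 1) || (i == 1 && j == 0) ||
    (i == 2 && j == 1) || (i == 3 && j == 2)⟩

end BMat

open BMat

def Emb2 (l n : ℕ) (PT PB T B : ℕ → Prop) (τ β : ℕ → ℕ) : Prop :=
  (∀ j < l, τ j < n ∧ β j < n) ∧ (∀ j < l, PT j → T (τ j)) ∧ (∀ j < l, PB j → B (β j)) ∧
  (∀ j j', j < j' → j' < l → τ j < τ j' ∧ τ j < β j' ∧ β j < τ j' ∧ β j < β j')

theorem emb_left {l n j0 c p g : ℕ} {PT PB T B : ℕ → Prop} {τ β : ℕ → ℕ} (hj0 : j0 < l)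
    (hemb : Emb2 l n PT PB (fun x => T x ∨ x = c) B τ β) (hτ : τ j0 = c)
    (hno : ∀ τ' β', ¬ Emb2 l n PT PB T B τ' β')
    (hpg : p ≤ g) (hgc : g < c) (hTg : T g)
    (τ' β' : ℕ → ℕ)
    (h1 : ∀ j < j0, τ' j < p ∧ β' j < p ∧ (PT j → T (τ' j)) ∧ (PB j → B (β' j)))
    (h2 : ∀ j j', j < j' → j' < j0 → τ' j < τ' j' ∧ τ' j < β' j' ∧ β' j < τ' j' ∧ β' j < β' j') :
    False := by
  obtain ⟨e1, e2, e3, e4⟩ := hemb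
  have hcn := (e1 j0 hj0).1
  have hne : ∀ j < l, j ≠ j0 → PT j → T (τ j) := by
    intro j hj hjj hp
    rcases e2 j hj hp with h | h
    · exact h
    · rcases lt_or_gt_of_ne hjj with h' | h'
      · have := e4 _ _ h' hj0; omega
      · have := e4 _ _ h' hj; omega
  by_cases hc : PB j0 ∧ β j0 < p
  · refine hno (fun j => if j = j0 then g else τ j) β ⟨?_, ?_, e3, ?_⟩
    · intro j hj
      have := e1 j hj
      dsimp only
      split_ifs <;> omega
    · intro j hj hp
      dsimp only
      split_ifs with h
      · exact hTg
      · exact hne j hj h hp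
    · intro j j' hjj hj'
      have a1 := e4 j j' hjj hj'
      have a2 := e4 j j0
      have a3 := e4 j0 j'
      dsimp only
      split_ifs with h h' h'
      · omega
      · have := a3 (by omega) hj'; subst h; omega
      · have := a2 (by omega) hj0; subst h'; omega
      · omega
  · refine hno (fun j => if j < j0 then τ' j else if j = j0 then g else τ j)
      (fun j => open Classical in if j < j0 then β' j else if j = j0 ∧ ¬ PB j0 then g else β j) ⟨?_, ?_, ?_, ?_⟩
    · intro j hj
      have := e1 j hj
      have := h1 j
      dsimp only
      split_ifs <;> omega
    · intro j hj hp
      dsimp only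
      split_ifs with h h'
      · exact (h1 j h).2.2.1 hp
      · exact hTg
      · exact hne j hj h' hp
    · intro j hj hp
      dsimp only
      split_ifs with h h'
      · exact (h1 j h).2.2.2 hp
      · exact absurd (h'.1 ▸ hp) h'.2
      · exact e3 j hj hp
    · intro j j' hjj hj'
      have a1 := e4 j j' hjj hj'
      have a3 := e4 j0 j'
      have b1 := h1 j
      have b2 := h2 j j' hjj
      have hc' : PB j0 → p ≤ β j0 := fun h => by
        by_contra hh
        exact hc ⟨h, by omega⟩
      dsimp only
      rcases lt_trichotomy j' j0 with h | h | h
      · have := b2 h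
        simp only [h, show j < j0 by omega, if_true]
        exact this
      · subst h
        simp only [hjj, if_true, lt_irrefl, if_false, true_and]
        have := b1 hjj
        split_ifs with hh
        · omega
        · have := hc' (by tauto); omega
      · have a3 := a3 h hj'
        simp only [show ¬ j' < j0 by omega, show ¬ j' = j0 by omega, if_false, false_and]
        rcases lt_trichotomy j j0 with k | k | k
        · have := b1 k
          simp only [k, if_true]
          have q1 : c < τ j' := by omega
          omega
        · subst k
          simp only [lt_irrefl, if_true, if_false, true_and]
          split_ifs <;> omega
        · simp only [show ¬ j < j0 by omega, show ¬ j = j0 by omega, if_false, false_and]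
          exact a1

theorem emb_right {l n j0 c q g : ℕ} {PT PB T B : ℕ → Prop} {τ β : ℕ → ℕ} (hj0 : j0 < l)
    (hemb : Emb2 l n PT PB (fun x => T x ∨ x = c) B τ β) (hτ : τ j0 = c)
    (hno : ∀ τ' β', ¬ Emb2 l n PT PB T B τ' β')
    (hpg : g < q) (hgc : c < g) (hgn : g < n) (hTg : T g)
    (τ' β' : ℕ → ℕ)
    (h1 : ∀ j, j0 < j → j < l → q ≤ τ' j ∧ q ≤ β' j ∧ τ' j < n ∧ β' j < n ∧
      (PT j → T (τ' j)) ∧ (PB j → B (β' j)))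
    (h2 : ∀ j j', j0 < j → j < j' → j' < l →
      τ' j < τ' j' ∧ τ' j < β' j' ∧ β' j < τ' j' ∧ β' j < β' j') :
    False := by
  obtain ⟨e1, e2, e3, e4⟩ := hemb
  have hcn := (e1 j0 hj0).1
  have hne : ∀ j < l, j ≠ j0 → PT j → T (τ j) := by
    intro j hj hjj hp
    rcases e2 j hj hp with h | h
    · exact h
    · rcases lt_or_gt_of_ne hjj with h' | h'
      · have := e4 _ _ h' hj0; omega
      · have := e4 _ _ h' hj; omega
  by_cases hc : PB j0 ∧ q ≤ β j0
  · refine hno (fun j => if j = j0 then g else τ j) β ⟨?_, ?_, e3, ?_⟩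
    · intro j hj
      have := e1 j hj
      dsimp only
      split_ifs <;> omega
    · intro j hj hp
      dsimp only
      split_ifs with h
      · exact hTg
      · exact hne j hj h hp
    · intro j j' hjj hj'
      have a1 := e4 j j' hjj hj'
      have a2 := e4 j j0
      have a3 := e4 j0 j'
      dsimp only
      split_ifs with h h' h'
      · omega
      · have := a3 (by omega) hj'; subst h; omega
      · have := a2 (by omega) hj0; subst h'; omega
      · omega
  · refine hno (fun j => if j0 < j then τ' j else if j = j0 then g else τ j)
      (fun j => open Classical in if j0 < j then β' j else if j = j0 ∧ ¬ PB j0 then g else β j) ⟨?_, ?_, ?_, ?_⟩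
    · intro j hj
      have := e1 j hj
      have := h1 j
      dsimp only
      split_ifs <;> omega
    · intro j hj hp
      dsimp only
      split_ifs with h h'
      · exact (h1 j h hj).2.2.2.2.1 hp
      · exact hTg
      · exact hne j hj h' hp
    · intro j hj hp
      dsimp only
      split_ifs with h h'
      · exact (h1 j h hj).2.2.2.2.2 hp
      · exact absurd (h'.1 ▸ hp) h'.2
      · exact e3 j hj hp
    · intro j j' hjj hj'
      have a1 := e4 j j' hjj hj'
      have a3 := e4 j j0
      have b1 := h1 j'
      have b2 := h2 j j'
      have hc' : PB j0 → β j0 < q := fun h => by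
        by_contra hh
        exact hc ⟨h, by omega⟩
      dsimp only
      rcases lt_trichotomy j j0 with h | h | h
      · have a3 := a3 h hj0
        simp only [show ¬ j0 < j by omega, show ¬ j = j0 by omega, if_false, false_and]
        rcases lt_trichotomy j' j0 with k | k | k
        · simp only [show ¬ j0 < j' by omega, show ¬ j' = j0 by omega, if_false, false_and]
          exact a1
        · subst k
          simp only [lt_irrefl, if_true, if_false, true_and]
          split_ifs <;> omega
        · have := b1 k hj'
          simp only [k, if_true]
          omega
      · subst h
        simp only [hjj, if_true, lt_irrefl, if_false, true_and]
        have := b1 hjj hj'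
        split_ifs with hh
        · omega
        · have := hc' (by tauto); omega
      · have := b2 h hjj hj'
        simp only [h, show j0 < j' by omega, if_true]
        exact this

theorem find_gap (c : ℕ → ℕ) (s k b : ℕ) (h1 : c s ≤ b) (h2 : b < c (s + k)) :
    ∃ t, s ≤ t ∧ t < s + k ∧ c t ≤ b ∧ b < c (t + 1) := by
  induction k with
  | zero => simp at h2; omega
  | succ k ih =>
    by_cases h : b < c (s + k)
    · obtain ⟨t, a, b', d⟩ := ih h
      exact ⟨t, a, by omega, d⟩
    · exact ⟨s + k, by omega, by omega, by omega, by simpa [add_assoc] using h2⟩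

/-- enumerate a finite set of naturals -/
theorem enum_finset (S : Finset ℕ) (k : ℕ) (hk : k ≤ S.card) :
    ∃ f : ℕ → ℕ, (∀ j < k, f j ∈ S) ∧ ∀ i j, i < j → j < k → f i < f j := by
  refine ⟨fun j => if h : j < S.card then S.orderEmbOfFin rfl ⟨j, h⟩ else 0, ?_, ?_⟩
  · intro j hj
    have h : j < S.card := by omega
    simp only [h, dif_pos]
    exact S.orderEmbOfFin_mem rfl _
  · intro i j hij hj
    have h : j < S.card := by omega
    have h' : i < S.card := by omega
    simp only [h, h', dif_pos]
    exact (S.orderEmbOfFin rfl).strictMono hij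

theorem free_block (l : ℕ) (K : Finset ℕ) (hK : K.card < l) :
    ∃ i < l, ∀ t, i * l ≤ t → t < i * l + l → t ∉ K := by
  by_contra hcon
  push Not at hcon
  have : (Finset.range l).card ≤ (K.image (fun t => t / l)).card := by
    apply Finset.card_le_card
    intro i hi
    obtain ⟨t, h1, h2, h3⟩ := hcon i (Finset.mem_range.mp hi)
    refine Finset.mem_image.mpr ⟨t, h3, ?_⟩
    apply Nat.div_eq_of_lt_le
    · exact h1
    · rw [Nat.add_mul]; omega
  have h2 := Finset.card_image_le (s := K) (f := fun t => t / l)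
  simp at this
  omega

theorem core (l n j0 N : ℕ) (hj0 : j0 < l) (PT PB : ℕ → Prop) (T B : ℕ → ℕ → Prop)
    (hN : N = l * l) (c g : ℕ → ℕ) (τ β : ℕ → ℕ → ℕ)
    (hc : ∀ t < N, c t < g t ∧ g t < c (t + 1))
    (hR : ∀ t ≤ N, ∀ s < N, T t (g s))
    (hB : ∃ u ≤ N, ∀ t ≤ N, ∀ x, B t x → B u x)
    (hcrit : ∀ t ≤ N, Emb2 l n PT PB (fun x => T t x ∨ x = c t) (B t) (τ t) (β t) ∧
      τ t j0 = c t)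
    (hno : ∀ t ≤ N, ∀ τ' β', ¬ Emb2 l n PT PB (T t) (B t) τ' β') : False := by
  classical
  have hcm : ∀ t s, t ≤ s → s ≤ N → c t ≤ c s := by
    intro t s hts
    induction s, hts using Nat.le_induction with
    | base => intro _; exact le_rfl
    | succ s hs ih => intro h; have := hc s (by omega); have := ih (by omega); omega
  have hcn : ∀ t ≤ N, c t < n := by
    intro t ht
    have := (hcrit t ht).1.1 j0 hj0
    rw [(hcrit t ht).2] at this
    exact this.1
  obtain ⟨u, hu, huB⟩ := hB
  set K : Finset ℕ := (Finset.range N).filter (fun s => ∃ b, B u b ∧ c s ≤ b ∧ b < c (s + 1))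
    with hKdef
  have hKm : ∀ s, s ∈ K → s < N ∧ ∃ b, B u b ∧ c s ≤ b ∧ b < c (s + 1) := by
    intro s hs
    simpa [hKdef] using hs
  have hb : ∃ bb : ℕ → ℕ, ∀ s ∈ K, B u (bb s) ∧ c s ≤ bb s ∧ bb s < c (s + 1) := by
    choose! bb hbb using fun s (hs : s ∈ K) => (hKm s hs).2
    exact ⟨bb, hbb⟩
  obtain ⟨bb, hbb⟩ := hb
  -- left claim
  have hleft : 1 ≤ u → (K.filter (fun s => s + 1 < u)).card < j0 := by
    intro hu1
    by_contra hcon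
    obtain ⟨f, hf1, hf2⟩ := enum_finset (K.filter (fun s => s + 1 < u)) j0 (by omega)
    obtain ⟨v, rfl⟩ : ∃ v, u = v + 1 := ⟨u - 1, by omega⟩
    have hv := hc v (by omega)
    refine emb_left (p := c v) (g := g v) hj0 (hcrit _ hu).1 (hcrit _ hu).2 (hno _ hu)
      (by omega) hv.2 (hR _ hu v (by omega)) (fun j => g (f j)) (fun j => bb (f j)) ?_ ?_
    · intro j hj
      have h := Finset.mem_filter.mp (hf1 j hj)
      have h1 := hc (f j) (by omega)
      have h2 := hbb _ h.1
      have h3 := hcm (f j + 1) v (by omega) (by omega)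
      exact ⟨by omega, by omega, fun _ => hR _ hu _ (by omega), fun _ => h2.1⟩
    · intro j j' hjj hj'
      have h := Finset.mem_filter.mp (hf1 j (by omega))
      have h' := Finset.mem_filter.mp (hf1 j' (by omega))
      have h1 := hc (f j) (by omega)
      have h2 := hbb _ h.1
      have h1' := hc (f j') (by omega)
      have h2' := hbb _ h'.1
      have h3 := hf2 j j' hjj hj'
      have h4 := hcm (f j + 1) (f j') (by omega) (by omega)
      try dsimp only
      omega
  have hright : u + 1 ≤ N → (K.filter (fun s => u < s)).card < l - 1 - j0 := by
    intro hu1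
    by_contra hcon
    obtain ⟨f, hf1, hf2⟩ := enum_finset (K.filter (fun s => u < s)) (l - 1 - j0) (by omega)
    have hv := hc u (by omega)
    have hun := hcn (u + 1) hu1
    refine emb_right (q := c (u + 1)) (g := g u) hj0 (hcrit _ hu).1 (hcrit _ hu).2 (hno _ hu)
      hv.2 hv.1 (by omega) (hR _ hu u (by omega))
      (fun j => g (f (j - 1 - j0))) (fun j => bb (f (j - 1 - j0))) ?_ ?_
    · intro j hj0 hj
      have h := Finset.mem_filter.mp (hf1 (j - 1 - j0) (by omega))
      have hN' := (hKm _ h.1).1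
      have h1 := hc (f (j - 1 - j0)) hN'
      have h2 := hbb _ h.1
      have h3 := hcm (u + 1) (f (j - 1 - j0)) (by omega) (by omega)
      have h4 := hcn (f (j - 1 - j0) + 1) (by omega)
      exact ⟨by omega, by omega, by omega, by omega, fun _ => hR _ hu _ (by omega), fun _ => h2.1⟩
    · intro j j' hj hjj hj'
      have h := Finset.mem_filter.mp (hf1 (j - 1 - j0) (by omega))
      have h' := Finset.mem_filter.mp (hf1 (j' - 1 - j0) (by omega))
      have hN' := (hKm _ h'.1).1
      have h3 := hf2 (j - 1 - j0) (j' - 1 - j0) (by omega) (by omega)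
      have h1 := hc (f (j - 1 - j0)) (by omega)
      have h2 := hbb _ h.1
      have h1' := hc (f (j' - 1 - j0)) (by omega)
      have h2' := hbb _ h'.1
      have h4 := hcm (f (j - 1 - j0) + 1) (f (j' - 1 - j0)) (by omega) (by omega)
      try dsimp only
      omega
  have hKcard : K.card < l := by
    by_cases h0 : u = 0
    · have hsub : K ⊆ K.filter (fun s => u < s) ∪ {0} := by
        intro s hs
        simp only [Finset.mem_union, Finset.mem_filter, Finset.mem_singleton]
        by_cases h : s = 0
        · exact Or.inr h
        · exact Or.inl ⟨hs, by omega⟩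
      have h1 := Finset.card_le_card hsub
      have h2 := Finset.card_union_le (K.filter (fun s => u < s)) {0}
      have h3 := hright (by
        have : 0 < l * l := Nat.mul_pos (by omega) (by omega)
        omega)
      simp only [Finset.card_singleton] at h2
      omega
    · have h3 := hleft (by omega)
      by_cases hN' : u = N
      · have hsub : K ⊆ K.filter (fun s => s + 1 < u) ∪ {u - 1} := by
          intro s hs
          have := (hKm s hs).1
          simp only [Finset.mem_union, Finset.mem_filter, Finset.mem_singleton]
          by_cases h : s = u - 1
          · exact Or.inr h
          · exact Or.inl ⟨hs, by omega⟩
        have h1 := Finset.card_le_card hsub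
        have h2 := Finset.card_union_le (K.filter (fun s => s + 1 < u)) {u - 1}
        simp only [Finset.card_singleton] at h2
        omega
      · have h4 := hright (by omega)
        have hsub : K ⊆ (K.filter (fun s => s + 1 < u) ∪ K.filter (fun s => u < s))
            ∪ {u - 1, u} := by
          intro s hs
          simp only [Finset.mem_union, Finset.mem_filter, Finset.mem_singleton, Finset.mem_insert]
          by_cases h : s + 1 < u
          · exact Or.inl (Or.inl ⟨hs, h⟩)
          · by_cases h' : u < s
            · exact Or.inl (Or.inr ⟨hs, h'⟩)
            · exact Or.inr (by omega)
        have h1 := Finset.card_le_card hsub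
        have h2 := Finset.card_union_le
          (K.filter (fun s => s + 1 < u) ∪ K.filter (fun s => u < s)) {u - 1, u}
        have h5 := Finset.card_union_le
          (K.filter (fun s => s + 1 < u)) (K.filter (fun s => u < s))
        have h6 := Finset.card_le_two (a := u - 1) (b := u)
        omega
  obtain ⟨i, hi, hfree⟩ := free_block l K hKcard
  set s := i * l with hs
  have hsN : s + l ≤ N := by
    have : (i + 1) * l ≤ l * l := Nat.mul_le_mul_right _ (by omega)
    rw [Nat.add_mul] at this
    omega
  have hnoB : ∀ b, B (s + l) b → c s ≤ b → b < c (s + l) → False := by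
    intro b hbB h1 h2
    obtain ⟨t, t1, t2, t3, t4⟩ := find_gap c s l b h1 h2
    apply hfree t t1 t2
    simp only [hKdef, Finset.mem_filter, Finset.mem_range]
    exact ⟨by omega, b, huB _ hsN _ hbB, t3, t4⟩
  -- the index J
  have hJ : ∃ J ≤ j0, (∀ j, J ≤ j → j < j0 → ¬ PB j) ∧ (J = 0 ∨ PB (J - 1)) := by
    clear * -
    induction j0 with
    | zero => exact ⟨0, le_rfl, by intros; omega, Or.inl rfl⟩
    | succ k ih =>
      by_cases h : PB k
      · exact ⟨k + 1, le_rfl, by intros; omega, Or.inr (by simpa using h)⟩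
      · obtain ⟨J, a, b, d⟩ := ih
        refine ⟨J, by omega, ?_, d⟩
        intro j h1 h2
        by_cases hjk : j = k
        · subst hjk; exact h
        · exact b j h1 (by omega)
  obtain ⟨J, hJ0, hJ1, hJ2⟩ := hJ
  obtain ⟨⟨e1, e2, e3, e4⟩, e5⟩ := hcrit (s + l) hsN
  have hJB : 0 < J → β (s + l) (J - 1) < c s := by
    intro hJp
    rcases hJ2 with h | h
    · omega
    · by_contra hcon
      have := e4 (J - 1) j0 (by omega) hj0
      exact hnoB _ (e3 (J - 1) (by omega) h) (by omega) (by omega)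
  have hlast := hc (s + l - 1) (by omega)
  rw [show s + l - 1 + 1 = s + l by omega] at hlast
  refine emb_left (p := c (s + l - 1)) (g := g (s + l - 1)) hj0 (hcrit _ hsN).1 (hcrit _ hsN).2
    (hno _ hsN) (by omega) hlast.2 (hR _ hsN _ (by omega))
    (fun j => if j + 1 < J then τ (s + l) j else g (s + j))
    (fun j => if j < J then β (s + l) j else g (s + j)) ?_ ?_
  · intro j hj
    have k1 := hc (s + j) (by omega)
    have k2 := hcm (s + j + 1) (s + l - 1) (by omega) (by omega)
    have k3 := hcm s (s + j) (by omega) (by omega)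
    have k4 := e4 j (J - 1)
    try dsimp only
    refine ⟨?_, ?_, ?_, ?_⟩
    · split_ifs with h
      · have := k4 (by omega) (by omega); omega
      · omega
    · split_ifs with h
      · by_cases hh : j = J - 1
        · subst hh; omega
        · have := k4 (by omega) (by omega); omega
      · omega
    · intro hp
      split_ifs with h
      · rcases e2 j (by omega) hp with h' | h'
        · exact h'
        · have := e4 j j0 hj hj0; omega
      · exact hR _ hsN _ (by omega)
    · intro hp
      split_ifs with h
      · exact e3 j (by omega) hp
      · exact absurd hp (hJ1 j (by omega) hj)
  · intro j j' hjj hj'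
    have k1 := hc (s + j) (by omega)
    have k1' := hc (s + j') (by omega)
    have k2 := hcm (s + j + 1) (s + j') (by omega) (by omega)
    have k3 := hcm s (s + j) (by omega) (by omega)
    have k4 := e4 j (J - 1)
    have k5 := e4 j j' hjj (by omega)
    have k6 : j < J → β (s + l) j < c s := by
      intro h
      by_cases hh : j = J - 1
      · subst hh; omega
      · have := k4 (by omega) (by omega); omega
    have k7 : j + 1 < J → τ (s + l) j < c s := by
      intro h
      have := k4 (by omega) (by omega); omega
    try dsimp only
    split_ifs <;> omega

def IPart (m k : ℕ) (g : ℕ → ℕ) : Prop :=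
  (∀ x < m, g x < k) ∧ (∀ i < k, ∃ x < m, g x = i) ∧ (∀ x x', x ≤ x' → x' < m → g x ≤ g x')

def Minor2 (P M : BMat) : Prop :=
  ∃ g h, IPart M.m P.m g ∧ IPart M.n P.n h ∧
    ∀ i j, i < P.m → j < P.n → P.entry i j = true →
      ∃ a b, a < M.m ∧ b < M.n ∧ g a = i ∧ h b = j ∧ M.entry a b = true

theorem part_id (m : ℕ) : IPart m m id :=
  ⟨fun x h => h, fun i h => ⟨i, h, rfl⟩, fun _ _ h _ => h⟩

theorem part_pull {m k r : ℕ} {g : ℕ → ℕ} (hr : r + 1 < m + 1) (h : IPart m k g) :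
    IPart (m + 1) k (fun x => g (if x ≤ r then x else x - 1)) := by
  obtain ⟨h1, h2, h3⟩ := h
  refine ⟨?_, ?_, ?_⟩
  · intro x hx
    apply h1
    split_ifs <;> omega
  · intro i hi
    obtain ⟨x, hx, rfl⟩ := h2 i hi
    refine ⟨if x ≤ r then x else x + 1, by split_ifs <;> omega, ?_⟩
    dsimp only
    congr 1
    split_ifs <;> omega
  · intro x x' hx hx'
    apply h3
    · split_ifs <;> omega
    · split_ifs <;> omega

theorem part_push {m k r : ℕ} {g : ℕ → ℕ} (hr : r + 1 < m) (h : IPart m k g)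
    (hg : g r = g (r + 1)) :
    IPart (m - 1) k (fun x => g (if x ≤ r then x else x + 1)) ∧
    ∀ a < m, (if a ≤ r then a else a - 1) < m - 1 ∧
      (fun x => g (if x ≤ r then x else x + 1)) (if a ≤ r then a else a - 1) = g a := by
  obtain ⟨h1, h2, h3⟩ := h
  have key : ∀ a < m, (if a ≤ r then a else a - 1) < m - 1 ∧
      (fun x => g (if x ≤ r then x else x + 1)) (if a ≤ r then a else a - 1) = g a := by
    intro a ha
    refine ⟨by split_ifs <;> omega, ?_⟩
    dsimp only
    by_cases h : a ≤ r
    · simp [h]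
    · by_cases h' : a = r + 1
      · subst h'; simp [hg]
      · rw [if_neg h, if_neg (by omega)]
        congr 1; omega
  refine ⟨⟨?_, ?_, ?_⟩, key⟩
  · intro x hx
    apply h1
    split_ifs <;> omega
  · intro i hi
    obtain ⟨x, hx, rfl⟩ := h2 i hi
    exact ⟨_, (key x hx).1, (key x hx).2⟩
  · intro x x' hx hx'
    apply h3
    · split_ifs <;> omega
    · split_ifs <;> omega

theorem part_strict {m k : ℕ} {g : ℕ → ℕ} (h : IPart m k g)
    (hg : ∀ r, r + 1 < m → g r ≠ g (r + 1)) : m = k ∧ ∀ x < m, g x = x := by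
  obtain ⟨h1, h2, h3⟩ := h
  have hs : ∀ x x', x < x' → x' < m → g x < g x' := by
    intro x x' hx hx'
    have a1 := h3 x (x + 1) (by omega) (by omega)
    have a2 := hg x (by omega)
    have a3 := h3 (x + 1) x' (by omega) hx'
    omega
  have hid : ∀ x < m, g x = x := by
    intro x
    induction x using Nat.strong_induction_on with
    | _ x ih =>
      intro hx
      have hge : x ≤ g x := by
        rcases Nat.eq_zero_or_pos x with h0 | h0
        · omega
        · have := ih (x - 1) (by omega) (by omega)
          have := hs (x - 1) x (by omega) hx
          omega
      have := h1 x hx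
      obtain ⟨x', hx', hxe⟩ := h2 x (by omega)
      rcases lt_trichotomy x' x with h | h | h
      · have := ih x' h hx'; omega
      · subst h; exact hxe
      · have := hs x x' h hx'; omega
  refine ⟨le_antisymm ?_ ?_, hid⟩
  · by_contra hcon
    have := h1 (m - 1) (by omega)
    have := hid (m - 1) (by omega)
    omega
  · by_contra hcon
    obtain ⟨x, hx, hxe⟩ := h2 m (by omega)
    have := hid x hx
    omega

theorem minor2_of_con {P M M' : BMat} (hc : Con M M') (h : Minor2 P M') : Minor2 P M := by
  obtain ⟨g, h, hg, hh, he⟩ := h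
  rcases hc with ⟨r, hr, hm, hn, hent⟩ | ⟨r, hr, hn, hm, hent⟩
  · refine ⟨_, h, hm ▸ part_pull (r := r) (by omega) hg, hn ▸ hh, ?_⟩
    intro i j hi hj hP
    obtain ⟨a, b, ha, hb, rfl, rfl, hM⟩ := he i j hi hj hP
    rw [hent a b ha hb] at hM
    split_ifs at hM with h1 h2
    · exact ⟨a, b, by omega, by omega, by simp [h1.le], rfl, hM⟩
    · subst h2
      rcases Bool.or_eq_true _ _ ▸ hM with h3 | h3
      · exact ⟨a, b, by omega, by omega, by simp, rfl, h3⟩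
      · exact ⟨a + 1, b, by omega, by omega, by simp, rfl, h3⟩
    · exact ⟨a + 1, b, by omega, by omega, by simp [show ¬ a + 1 ≤ r by omega], rfl, hM⟩
  · refine ⟨g, _, hm ▸ hg, hn ▸ part_pull (r := r) (by omega) hh, ?_⟩
    intro i j hi hj hP
    obtain ⟨a, b, ha, hb, rfl, rfl, hM⟩ := he i j hi hj hP
    rw [hent a b ha hb] at hM
    split_ifs at hM with h1 h2
    · exact ⟨a, b, by omega, by omega, rfl, by simp [h1.le], hM⟩
    · subst h2
      rcases Bool.or_eq_true _ _ ▸ hM with h3 | h3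
      · exact ⟨a, b, by omega, by omega, rfl, by simp, h3⟩
      · exact ⟨a, b + 1, by omega, by omega, rfl, by simp, h3⟩
    · exact ⟨a, b + 1, by omega, by omega, rfl, by simp [show ¬ b + 1 ≤ r by omega], hM⟩

theorem minor2_of_minor {P M : BMat} (h : IntervalMinor P M) : Minor2 P M := by
  obtain ⟨M', hM, hm, hn, he⟩ := h
  induction hM using Relation.ReflTransGen.head_induction_on with
  | refl =>
    refine ⟨id, id, hm ▸ part_id _, hn ▸ part_id _, ?_⟩
    intro i j hi hj hP
    exact ⟨i, j, by omega, by omega, rfl, rfl, he i j hi hj hP⟩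
  | head hc _ ih => exact minor2_of_con hc ih

theorem minor_of_minor2 {P : BMat} (d : ℕ) : ∀ M : BMat, M.m + M.n = d → Minor2 P M →
    IntervalMinor P M := by
  induction d with
  | zero =>
    rintro M hd ⟨g, h, hg, hh, he⟩
    obtain ⟨h1, h2⟩ := part_strict hg (by intros; omega)
    obtain ⟨h3, h4⟩ := part_strict hh (by intros; omega)
    refine ⟨M, Relation.ReflTransGen.refl, h1, h3, ?_⟩
    intro i j hi; omega
  | succ d ih =>
    rintro M hd ⟨g, h, hg, hh, he⟩
    by_cases hr : ∃ r, r + 1 < M.m ∧ g r = g (r + 1)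
    · obtain ⟨r, hr, hgr⟩ := hr
      obtain ⟨p1, p2⟩ := part_push hr hg hgr
      let M1 : BMat := ⟨M.m - 1, M.n, fun i j => if i < r then M.entry i j
        else if i = r then (M.entry r j || M.entry (r + 1) j) else M.entry (i + 1) j⟩
      have hcon : Con M M1 := Or.inl ⟨r, hr, by simp only [M1]; omega, rfl, fun _ _ _ _ => rfl⟩
      obtain ⟨M', q1, q2⟩ := ih M1 (by simp only [M1]; omega) ⟨_, h, p1, hh, by
        intro i j hi hj hP
        obtain ⟨a, b, ha, hb, rfl, rfl, hM⟩ := he i j hi hj hP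
        refine ⟨_, b, (p2 a ha).1, hb, (p2 a ha).2, rfl, ?_⟩
        simp only [M1]
        rcases lt_trichotomy a r with k | k | k
        · simp [k.le, k, hM]
        · subst k; simp [hM]
        · by_cases k' : a = r + 1
          · subst k'; simp [hM]
          · simp only [show ¬ a ≤ r by omega, if_false, show ¬ a - 1 < r by omega,
              show ¬ a - 1 = r by omega, show a - 1 + 1 = a by omega, hM]⟩
      exact ⟨M', Relation.ReflTransGen.head hcon q1, q2⟩
    · by_cases hr' : ∃ r, r + 1 < M.n ∧ h r = h (r + 1)
      · obtain ⟨r, hr, hgr⟩ := hr'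
        obtain ⟨p1, p2⟩ := part_push hr hh hgr
        let M1 : BMat := ⟨M.m, M.n - 1, fun i j => if j < r then M.entry i j
          else if j = r then (M.entry i r || M.entry i (r + 1)) else M.entry i (j + 1)⟩
        have hcon : Con M M1 := Or.inr ⟨r, hr, by simp only [M1]; omega, rfl, fun _ _ _ _ => rfl⟩
        obtain ⟨M', q1, q2⟩ := ih M1 (by simp only [M1]; omega) ⟨g, _, hg, p1, by
          intro i j hi hj hP
          obtain ⟨b, a, hb, ha, rfl, rfl, hM⟩ := he i j hi hj hP
          refine ⟨b, _, hb, (p2 a ha).1, rfl, (p2 a ha).2, ?_⟩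
          simp only [M1]
          rcases lt_trichotomy a r with k | k | k
          · simp [k.le, k, hM]
          · subst k; simp [hM]
          · by_cases k' : a = r + 1
            · subst k'; simp [hM]
            · simp only [show ¬ a ≤ r by omega, if_false, show ¬ a - 1 < r by omega,
                show ¬ a - 1 = r by omega, show a - 1 + 1 = a by omega, hM]⟩
        exact ⟨M', Relation.ReflTransGen.head hcon q1, q2⟩
      · push Not at hr hr'
        obtain ⟨h1, h2⟩ := part_strict hg hr
        obtain ⟨h3, h4⟩ := part_strict hh hr'
        refine ⟨M, Relation.ReflTransGen.refl, h1, h3, ?_⟩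
        intro i j hi hj hP
        obtain ⟨a, b, ha, hb, rfl, rfl, hM⟩ := he i j hi hj hP
        rw [h2 a ha, h4 b hb]; exact hM

theorem part_of_strict (m k w : ℕ) (F : ℕ → ℕ → ℕ) (hk : 0 < k) (hw : 0 < w)
    (h1 : ∀ i < k, ∀ j < w, F i j < m)
    (h2 : ∀ i i', i < i' → i' < k → ∀ j < w, ∀ j' < w, F i j < F i' j') :
    ∃ g, IPart m k g ∧ ∀ i < k, ∀ j < w, g (F i j) = i := by
  classical
  have hval : ∀ i < k, ∀ j < w,
      Nat.findGreatest (fun i' => ∃ j' < w, F i' j' ≤ F i j) (k - 1) = i := by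
    intro i hi j hj
    apply le_antisymm
    · by_contra hcon
      have hle := Nat.findGreatest_le (P := fun i' => ∃ j' < w, F i' j' ≤ F i j) (k - 1)
      obtain ⟨j', hj', hF⟩ := Nat.findGreatest_spec
        (P := fun i' => ∃ j' < w, F i' j' ≤ F i j) (n := k - 1) (m := i) (by omega)
        ⟨j, hj, le_rfl⟩
      have := h2 i _ (not_le.mp hcon) (by omega) j hj j' hj'
      omega
    · exact Nat.le_findGreatest (by omega) ⟨j, hj, le_rfl⟩
  refine ⟨fun x => Nat.findGreatest (fun i' => ∃ j' < w, F i' j' ≤ x) (k - 1),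
    ⟨?_, ?_, ?_⟩, hval⟩
  · intro x _
    have := Nat.findGreatest_le (P := fun i' => ∃ j' < w, F i' j' ≤ x) (k - 1)
    dsimp only
    omega
  · intro i hi
    exact ⟨F i 0, h1 i hi 0 hw, hval i hi 0 hw⟩
  · intro x x' hx _
    apply Nat.findGreatest_mono_left
    rintro i ⟨j, hj, hF⟩
    exact ⟨j, hj, hF.trans hx⟩

theorem minor_of_embedding {P M : BMat} (hm : 0 < P.m) (hn : 0 < P.n) (φ : ℕ → ℕ → ℕ × ℕ)
    (h : IsEmbedding P M φ) : IntervalMinor P M := by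
  obtain ⟨h1, h2, h3⟩ := h
  obtain ⟨g, hg, hg'⟩ := part_of_strict M.m P.m P.n (fun i j => (φ i j).1) hm hn
    (fun i hi j hj => (h1 i j hi hj).1)
    (fun i i' hii hi' j hj j' hj' => (h3 i j i' j' (by omega) hj hi' hj').1 hii)
  obtain ⟨f, hf, hf'⟩ := part_of_strict M.n P.n P.m (fun j i => (φ i j).2) hn hm
    (fun j hj i hi => (h1 i j hi hj).2)
    (fun j j' hjj hj' i hi i' hi' => (h3 i j i' j' hi (by omega) hi' hj').2 hjj)
  exact minor_of_minor2 _ M rfl ⟨g, f, hg, hf, fun i j hi hj hP =>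
    ⟨_, _, (h1 i j hi hj).1, (h1 i j hi hj).2, hg' i hi j hj, hf' j hj i hi, h2 i j hi hj hP⟩⟩

theorem embedding_of_minor {P M : BMat} (h : IntervalMinor P M) : ∃ φ, IsEmbedding P M φ := by
  obtain ⟨g, f, hg, hf, he⟩ := minor2_of_minor h
  have : ∀ i j, ∃ p : ℕ × ℕ, i < P.m → j < P.n → p.1 < M.m ∧ p.2 < M.n ∧ g p.1 = i ∧ f p.2 = j ∧
      (P.entry i j = true → M.entry p.1 p.2 = true) := by
    intro i j
    by_cases hi : i < P.m
    · by_cases hj : j < P.n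
      · by_cases hP : P.entry i j = true
        · obtain ⟨a, b, ha, hb, h1, h2, h3⟩ := he i j hi hj hP
          exact ⟨(a, b), fun _ _ => ⟨ha, hb, h1, h2, fun _ => h3⟩⟩
        · obtain ⟨a, ha, h1⟩ := hg.2.1 i hi
          obtain ⟨b, hb, h2⟩ := hf.2.1 j hj
          exact ⟨(a, b), fun _ _ => ⟨ha, hb, h1, h2, fun h => absurd h hP⟩⟩
      · exact ⟨(0, 0), fun _ h => absurd h hj⟩
    · exact ⟨(0, 0), fun h => absurd h hi⟩
  choose φ hφ using this
  refine ⟨φ, fun i j hi hj => ⟨(hφ i j hi hj).1, (hφ i j hi hj).2.1⟩,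
    fun i j hi hj => (hφ i j hi hj).2.2.2.2, ?_⟩
  intro i j i' j' hi hj hi' hj'
  obtain ⟨a1, a2, a3, a4, _⟩ := hφ i j hi hj
  obtain ⟨b1, b2, b3, b4, _⟩ := hφ i' j' hi' hj'
  constructor
  · intro hii
    by_contra hcon
    have := hg.2.2 _ _ (not_lt.mp hcon) a1
    omega
  · intro hjj
    by_contra hcon
    have := hf.2.2 _ _ (not_lt.mp hcon) a2
    omega

theorem emb_dist {P M : BMat} {φ : ℕ → ℕ → ℕ × ℕ} (h : IsEmbedding P M φ) (i j j' : ℕ)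
    (hj : j < P.n) (hj' : j' < P.n) : ∀ d, 0 < d → i + d < P.m →
    (φ i j).1 + d ≤ (φ (i + d) j').1 := by
  intro d hd
  induction d, hd using Nat.le_induction generalizing j' with
  | base =>
    intro hi
    exact (h.2.2 i j (i + 1) j' (by omega) hj hi hj').1 (by omega)
  | succ d hd ih =>
    intro hi
    have h1 := ih j' hj' (by omega)
    have h2 := (h.2.2 (i + d) j' (i + (d + 1)) j' (by omega) hj' hi hj').1 (by omega)
    omega

theorem emb_dist' {P M : BMat} {φ : ℕ → ℕ → ℕ × ℕ} (h : IsEmbedding P M φ) (i i' j j' : ℕ)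
    (hj : j < P.n) (hj' : j' < P.n) (hi : i < i') (hi' : i' < P.m) :
    (φ i j).1 + (i' - i) ≤ (φ i' j').1 := by
  have := emb_dist h i j j' hj hj' (i' - i) (by omega) (by omega)
  rwa [show i + (i' - i) = i' by omega] at this

theorem emb_low {P M : BMat} {φ : ℕ → ℕ → ℕ × ℕ} (h : IsEmbedding P M φ) (i j : ℕ)
    (hj : j < P.n) (hi : i < P.m) : i ≤ (φ i j).1 ∧ (φ i j).1 + (P.m - 1 - i) < M.m := by
  constructor
  · rcases Nat.eq_zero_or_pos i with h0 | h0
    · omega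
    · have := emb_dist' h 0 i j j hj hj h0 hi
      omega
  · by_cases h0 : i = P.m - 1
    · have := (h.1 i j hi hj).1; omega
    · have := emb_dist' h i (P.m - 1) j j hj hj (by omega) (by omega)
      have := (h.1 (P.m - 1) j (by omega) hj).1
      omega

theorem zone (P M : BMat) (i0 o j0 r : ℕ) (hi0 : i0 < P.m) (hj0 : j0 < P.n)
    (htwo : ∀ i j, i < P.m → j < P.n → P.entry i j = true → i = i0 ∨ i = o)
    (hav : ∀ φ, ¬ IsEmbedding P M φ) :
    ∃ (PB : ℕ → Prop) (T B : ℕ → ℕ → Prop),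
      (∀ y y', (∀ x, B y x → B y' x) ∨ (∀ x, B y' x → B y x)) ∧
      ∀ c φ, IsEmbedding P (setOne M r c) φ → φ i0 j0 = (r, c) →
        ∃ y, (∀ x, M.entry r x = true → T y x) ∧
          (∃ τ β, Emb2 P.n M.n (fun j => P.entry i0 j = true) PB (fun x => T y x ∨ x = c) (B y) τ β ∧
            τ j0 = c) ∧
          ∀ τ β, ¬ Emb2 P.n M.n (fun j => P.entry i0 j = true) PB (T y) (B y) τ β := by
  have hsub : ∀ c a b, (setOne M r c).entry a b = true → M.entry a b = true ∨ (a = r ∧ b = c) := by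
    intro c a b h
    simp only [setOne] at h
    split_ifs at h with h'
    · exact Or.inr h'
    · exact Or.inl h
  rcases lt_trichotomy i0 o with hio | hio | hio
  rotate_left
  · -- only one row
    subst hio
    refine ⟨fun _ => False, fun _ x => ∃ ρ, i0 ≤ ρ ∧ ρ + (P.m - 1 - i0) < M.m ∧ M.entry ρ x = true,
      fun _ _ => False, by tauto, ?_⟩
    intro c φ hφ hφc
    have hr := emb_low hφ i0 j0 hj0 hi0
    rw [hφc] at hr
    refine ⟨0, fun x hx => ⟨r, hr.1, hr.2, hx⟩, ⟨fun j => (φ i0 j).2, fun j => (φ i0 j).2,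
      ⟨fun j hj => ?_, ?_, by tauto, ?_⟩, by simp [hφc]⟩, ?_⟩
    · have := hφ.1 i0 j hi0 hj
      exact ⟨this.2, this.2⟩
    · intro j hj hP
      rcases hsub _ _ _ (hφ.2.1 i0 j hi0 hj hP) with h | h
      · have := emb_low hφ i0 j hj hi0
        exact Or.inl ⟨_, this.1, this.2, h⟩
      · exact Or.inr h.2
    · intro j j' hjj hj'
      have := (hφ.2.2 i0 j i0 j' hi0 (by omega) hi0 hj').2 hjj
      exact ⟨this, this, this, this⟩
    · rintro τ β ⟨h1, h2, h3, h4⟩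
      have : ∀ j, ∃ ρ, i0 ≤ ρ ∧ ρ + (P.m - 1 - i0) < M.m ∧ (j < P.n → P.entry i0 j = true →
          M.entry ρ (τ j) = true) := by
        intro j
        by_cases h : j < P.n ∧ P.entry i0 j = true
        · obtain ⟨ρ, a, b, d⟩ := h2 j h.1 h.2
          exact ⟨ρ, a, b, fun _ _ => d⟩
        · exact ⟨r, hr.1, hr.2, fun a b => absurd ⟨a, b⟩ h⟩
      choose ρ hρ1 hρ2 hρ3 using this
      refine hav (fun i j => (if i < i0 then i else if i = i0 then ρ j else i + M.m - P.m, τ j))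
        ⟨?_, ?_, ?_⟩
      · intro i j hi hj
        have := hρ2 j
        have := hρ1 j
        refine ⟨?_, (h1 j hj).1⟩
        dsimp only
        split_ifs <;> omega
      · intro i j hi hj hP
        have : i = i0 := by rcases htwo i j hi hj hP with h | h <;> exact h
        subst this
        simpa using hρ3 j hj hP
      · intro i j i' j' hi hj hi' hj'
        refine ⟨fun h => ?_, fun h => (h4 j j' h hj').1⟩
        have a1 := hρ1 j
        have a2 := hρ2 j
        have a3 := hρ1 j'
        have a4 := hρ2 j'
        dsimp only
        split_ifs <;> omega
  · -- o < i0
    refine ⟨fun j => P.entry o j = true,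
      fun y x => ∃ ρ, y ≤ ρ ∧ ρ + (P.m - 1 - i0) < M.m ∧ M.entry ρ x = true,
      fun y x => ∃ ρ, o ≤ ρ ∧ ρ + (i0 - o) ≤ y ∧ M.entry ρ x = true, ?_, ?_⟩
    · intro y y'
      rcases le_total y y' with h | h
      · left; rintro x ⟨ρ, a, b, d⟩; exact ⟨ρ, a, by omega, d⟩
      · right; rintro x ⟨ρ, a, b, d⟩; exact ⟨ρ, a, by omega, d⟩
    intro c φ hφ hφc
    have ho : o < P.m := by omega
    have hr := emb_low hφ i0 j0 hj0 hi0
    obtain ⟨y, ⟨jy, hjy, hy⟩, hymin⟩ : ∃ y, (∃ j < P.n, (φ i0 j).1 = y) ∧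
        ∀ j < P.n, y ≤ (φ i0 j).1 := by
      obtain ⟨j, hj, hmin⟩ := Finset.exists_min_image (Finset.range P.n) (fun j => (φ i0 j).1)
        ⟨j0, Finset.mem_range.mpr hj0⟩
      exact ⟨_, ⟨j, Finset.mem_range.mp hj, rfl⟩, fun j' hj' => hmin j' (Finset.mem_range.mpr hj')⟩
    have hyr := hymin j0 hj0
    rw [hφc] at hr hyr
    dsimp only at hr hyr
    have hy1 := emb_low hφ i0 jy hjy hi0
    have hy2 : (setOne M r c).m = M.m := rfl
    refine ⟨y, fun x hx => ⟨r, hyr, hr.2, hx⟩, ⟨fun j => (φ i0 j).2, fun j => (φ o j).2,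
      ⟨fun j hj => ?_, ?_, ?_, ?_⟩, by simp [hφc]⟩, ?_⟩
    · exact ⟨(hφ.1 i0 j hi0 hj).2, (hφ.1 o j ho hj).2⟩
    · intro j hj hP
      rcases hsub _ _ _ (hφ.2.1 i0 j hi0 hj hP) with h | h
      · have := emb_low hφ i0 j hj hi0
        exact Or.inl ⟨_, hymin j hj, this.2, h⟩
      · exact Or.inr h.2
    · intro j hj hP
      rcases hsub _ _ _ (hφ.2.1 o j ho hj hP) with h | h
      · refine ⟨_, (emb_low hφ o j hj ho).1, ?_, h⟩
        have := emb_dist' hφ o i0 j jy hj hjy hio hi0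
        omega
      · have := emb_dist' hφ o i0 j j0 hj hj0 hio hi0
        rw [hφc] at this
        dsimp only at this
        omega
    · intro j j' hjj hj'
      exact ⟨(hφ.2.2 i0 j i0 j' hi0 (by omega) hi0 hj').2 hjj,
        (hφ.2.2 i0 j o j' hi0 (by omega) ho hj').2 hjj,
        (hφ.2.2 o j i0 j' ho (by omega) hi0 hj').2 hjj,
        (hφ.2.2 o j o j' ho (by omega) ho hj').2 hjj⟩
    · rintro τ β ⟨h1, h2, h3, h4⟩
      have : ∀ j, ∃ ρ, y ≤ ρ ∧ ρ + (P.m - 1 - i0) < M.m ∧ (j < P.n → P.entry i0 j = true →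
          M.entry ρ (τ j) = true) := by
        intro j
        by_cases h : j < P.n ∧ P.entry i0 j = true
        · obtain ⟨ρ, a, b, d⟩ := h2 j h.1 h.2
          exact ⟨ρ, a, b, fun _ _ => d⟩
        · exact ⟨r, hyr, hr.2, fun a b => absurd ⟨a, b⟩ h⟩
      choose ρ hρ1 hρ2 hρ3 using this
      have : ∀ j, ∃ ρ, o ≤ ρ ∧ ρ + (i0 - o) ≤ y ∧ (j < P.n → P.entry o j = true →
          M.entry ρ (β j) = true) := by
        intro j
        by_cases h : j < P.n ∧ P.entry o j = true
        · obtain ⟨ρ, a, b, d⟩ := h3 j h.1 h.2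
          exact ⟨ρ, a, b, fun _ _ => d⟩
        · exact ⟨o, le_rfl, by omega, fun a b => absurd ⟨a, b⟩ h⟩
      choose σ hσ1 hσ2 hσ3 using this
      refine hav (fun i j => (if i < o then i else if i = o then σ j else if i < i0 then y - (i0 - i)
        else if i = i0 then ρ j else i + M.m - P.m, if i = o then β j else τ j))
        ⟨?_, ?_, ?_⟩
      · intro i j hi hj
        have := hρ2 j
        have := hσ2 j
        have := h1 j hj
        constructor
        · dsimp only
          split_ifs <;> omega
        · dsimp only
          split_ifs <;> omega
      · intro i j hi hj hP
        rcases htwo i j hi hj hP with h | h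
        · subst h
          simpa [hio.ne', hio.not_gt] using hρ3 j hj hP
        · subst h
          simpa using hσ3 j hj hP
      · intro i j i' j' hi hj hi' hj'
        refine ⟨fun h => ?_, fun h => ?_⟩
        · have a1 := hρ1 j
          have a2 := hρ2 j
          have a3 := hρ1 j'
          have a4 := hρ2 j'
          have b1 := hσ1 j
          have b2 := hσ2 j
          have b3 := hσ1 j'
          have b4 := hσ2 j'
          dsimp only
          split_ifs <;> omega
        · have := h4 j j' h hj'
          dsimp only
          split_ifs <;> omega
  · -- i0 < o
    by_cases ho : P.m ≤ o
    · -- reduce to the single row case by hand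
      refine ⟨fun _ => False, fun _ x => ∃ ρ, i0 ≤ ρ ∧ ρ + (P.m - 1 - i0) < M.m ∧ M.entry ρ x = true,
        fun _ _ => False, by tauto, ?_⟩
      intro c φ hφ hφc
      have hr := emb_low hφ i0 j0 hj0 hi0
      rw [hφc] at hr
      refine ⟨0, fun x hx => ⟨r, hr.1, hr.2, hx⟩, ⟨fun j => (φ i0 j).2, fun j => (φ i0 j).2,
        ⟨fun j hj => ?_, ?_, by tauto, ?_⟩, by simp [hφc]⟩, ?_⟩
      · have := hφ.1 i0 j hi0 hj
        exact ⟨this.2, this.2⟩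
      · intro j hj hP
        rcases hsub _ _ _ (hφ.2.1 i0 j hi0 hj hP) with h | h
        · have := emb_low hφ i0 j hj hi0
          exact Or.inl ⟨_, this.1, this.2, h⟩
        · exact Or.inr h.2
      · intro j j' hjj hj'
        have := (hφ.2.2 i0 j i0 j' hi0 (by omega) hi0 hj').2 hjj
        exact ⟨this, this, this, this⟩
      · rintro τ β ⟨h1, h2, h3, h4⟩
        have : ∀ j, ∃ ρ, i0 ≤ ρ ∧ ρ + (P.m - 1 - i0) < M.m ∧ (j < P.n → P.entry i0 j = true →
            M.entry ρ (τ j) = true) := by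
          intro j
          by_cases h : j < P.n ∧ P.entry i0 j = true
          · obtain ⟨ρ, a, b, d⟩ := h2 j h.1 h.2
            exact ⟨ρ, a, b, fun _ _ => d⟩
          · exact ⟨r, hr.1, hr.2, fun a b => absurd ⟨a, b⟩ h⟩
        choose ρ hρ1 hρ2 hρ3 using this
        refine hav (fun i j => (if i < i0 then i else if i = i0 then ρ j else i + M.m - P.m, τ j))
          ⟨?_, ?_, ?_⟩
        · intro i j hi hj
          have := hρ2 j
          have := hρ1 j
          refine ⟨?_, (h1 j hj).1⟩
          dsimp only
          split_ifs <;> omega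
        · intro i j hi hj hP
          have : i = i0 := by rcases htwo i j hi hj hP with h | h <;> omega
          subst this
          simpa using hρ3 j hj hP
        · intro i j i' j' hi hj hi' hj'
          refine ⟨fun h => ?_, fun h => (h4 j j' h hj').1⟩
          have a1 := hρ1 j
          have a2 := hρ2 j
          have a3 := hρ1 j'
          have a4 := hρ2 j'
          dsimp only
          split_ifs <;> omega
    have ho : o < P.m := by omega
    refine ⟨fun j => P.entry o j = true,
      fun y x => ∃ ρ, i0 ≤ ρ ∧ ρ ≤ y ∧ M.entry ρ x = true,
      fun y x => ∃ ρ, y + (o - i0) ≤ ρ ∧ ρ + (P.m - 1 - o) < M.m ∧ M.entry ρ x = true, ?_, ?_⟩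
    · intro y y'
      rcases le_total y y' with h | h
      · right; rintro x ⟨ρ, a, b, d⟩; exact ⟨ρ, by omega, b, d⟩
      · left; rintro x ⟨ρ, a, b, d⟩; exact ⟨ρ, by omega, b, d⟩
    intro c φ hφ hφc
    have hr := emb_low hφ i0 j0 hj0 hi0
    obtain ⟨y, ⟨jy, hjy, hy⟩, hymax⟩ : ∃ y, (∃ j < P.n, (φ i0 j).1 = y) ∧
        ∀ j < P.n, (φ i0 j).1 ≤ y := by
      obtain ⟨j, hj, hmin⟩ := Finset.exists_max_image (Finset.range P.n) (fun j => (φ i0 j).1)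
        ⟨j0, Finset.mem_range.mpr hj0⟩
      exact ⟨_, ⟨j, Finset.mem_range.mp hj, rfl⟩, fun j' hj' => hmin j' (Finset.mem_range.mpr hj')⟩
    have hyr := hymax j0 hj0
    rw [hφc] at hr hyr
    dsimp only at hr hyr
    have hy1 := emb_low hφ i0 jy hjy hi0
    have hy2 : (setOne M r c).m = M.m := rfl
    refine ⟨y, fun x hx => ⟨r, hr.1, hyr, hx⟩, ⟨fun j => (φ i0 j).2, fun j => (φ o j).2,
      ⟨fun j hj => ?_, ?_, ?_, ?_⟩, by simp [hφc]⟩, ?_⟩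
    · exact ⟨(hφ.1 i0 j hi0 hj).2, (hφ.1 o j ho hj).2⟩
    · intro j hj hP
      rcases hsub _ _ _ (hφ.2.1 i0 j hi0 hj hP) with h | h
      · have := emb_low hφ i0 j hj hi0
        exact Or.inl ⟨_, this.1, hymax j hj, h⟩
      · exact Or.inr h.2
    · intro j hj hP
      rcases hsub _ _ _ (hφ.2.1 o j ho hj hP) with h | h
      · refine ⟨_, ?_, (emb_low hφ o j hj ho).2, h⟩
        have := emb_dist' hφ i0 o jy j hjy hj hio ho
        omega
      · have := emb_dist' hφ i0 o j0 j hj0 hj hio ho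
        rw [hφc] at this
        dsimp only at this
        omega
    · intro j j' hjj hj'
      exact ⟨(hφ.2.2 i0 j i0 j' hi0 (by omega) hi0 hj').2 hjj,
        (hφ.2.2 i0 j o j' hi0 (by omega) ho hj').2 hjj,
        (hφ.2.2 o j i0 j' ho (by omega) hi0 hj').2 hjj,
        (hφ.2.2 o j o j' ho (by omega) ho hj').2 hjj⟩
    · rintro τ β ⟨h1, h2, h3, h4⟩
      have : ∀ j, ∃ ρ, i0 ≤ ρ ∧ ρ ≤ y ∧ (j < P.n → P.entry i0 j = true →
          M.entry ρ (τ j) = true) := by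
        intro j
        by_cases h : j < P.n ∧ P.entry i0 j = true
        · obtain ⟨ρ, a, b, d⟩ := h2 j h.1 h.2
          exact ⟨ρ, a, b, fun _ _ => d⟩
        · exact ⟨r, hr.1, hyr, fun a b => absurd ⟨a, b⟩ h⟩
      choose ρ hρ1 hρ2 hρ3 using this
      have : ∀ j, ∃ ρ, y + (o - i0) ≤ ρ ∧ ρ + (P.m - 1 - o) < M.m ∧ (j < P.n → P.entry o j = true →
          M.entry ρ (β j) = true) := by
        intro j
        by_cases h : j < P.n ∧ P.entry o j = true
        · obtain ⟨ρ, a, b, d⟩ := h3 j h.1 h.2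
          exact ⟨ρ, a, b, fun _ _ => d⟩
        · exact ⟨y + (o - i0), le_rfl, by omega, fun a b => absurd ⟨a, b⟩ h⟩
      choose σ hσ1 hσ2 hσ3 using this
      refine hav (fun i j => (if i < i0 then i else if i = i0 then ρ j else if i < o then y + (i - i0)
        else if i = o then σ j else i + M.m - P.m, if i = o then β j else τ j))
        ⟨?_, ?_, ?_⟩
      · intro i j hi hj
        have := hρ2 j
        have := hσ2 j
        have := h1 j hj
        constructor
        · dsimp only
          split_ifs <;> omega
        · dsimp only
          split_ifs <;> omega
      · intro i j hi hj hP
        rcases htwo i j hi hj hP with h | h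
        · subst h
          simpa [hio.ne] using hρ3 j hj hP
        · subst h
          simpa [hio.ne', hio.not_gt] using hσ3 j hj hP
      · intro i j i' j' hi hj hi' hj'
        refine ⟨fun h => ?_, fun h => ?_⟩
        · have a1 := hρ1 j
          have a2 := hρ2 j
          have a3 := hρ1 j'
          have a4 := hρ2 j'
          have b1 := hσ1 j
          have b2 := hσ2 j
          have b3 := hσ1 j'
          have b4 := hσ2 j'
          dsimp only
          split_ifs <;> omega
        · have := h4 j j' h hj'
          dsimp only
          split_ifs <;> omega

theorem chain_max (B : ℕ → ℕ → Prop) (y : ℕ → ℕ)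
    (h : ∀ y y', (∀ x, B y x → B y' x) ∨ (∀ x, B y' x → B y x)) (N : ℕ) :
    ∃ u ≤ N, ∀ t ≤ N, ∀ x, B (y t) x → B (y u) x := by
  induction N with
  | zero =>
    refine ⟨0, le_rfl, ?_⟩
    intro t ht x hx
    obtain rfl : t = 0 := by omega
    exact hx
  | succ N ih =>
    obtain ⟨u, hu, hu'⟩ := ih
    rcases h (y u) (y (N + 1)) with h1 | h1
    · refine ⟨N + 1, le_rfl, ?_⟩
      intro t ht x hx
      rcases Nat.lt_or_ge N t with h2 | h2
      · obtain rfl : t = N + 1 := by omega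
        exact hx
      · exact h1 x (hu' t h2 x hx)
    · refine ⟨u, by omega, ?_⟩
      intro t ht x hx
      rcases Nat.lt_or_ge N t with h2 | h2
      · obtain rfl : t = N + 1 := by omega
        exact h1 x hx
      · exact hu' t h2 x hx

theorem crit_finite (P : BMat) (e : ℕ × ℕ) (M : BMat) (r : ℕ) :
    {c₁ | ∃ c₂, ZeroRun M r c₁ c₂ ∧
      ∃ c, c₁ ≤ c ∧ c ≤ c₂ ∧ CritEntry P e M (r, c)}.Finite := by
  apply (Set.finite_lt_nat M.n).subset
  rintro s ⟨c₂, h, _⟩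
  have h1 := h.2.1
  have h2 := h.2.2.1
  show s < M.n
  omega

theorem crit_bound (P M : BMat) (i0 o j0 r : ℕ) (hi0 : i0 < P.m) (hj0 : j0 < P.n)
    (htwo : ∀ i j, i < P.m → j < P.n → P.entry i j = true → i = i0 ∨ i = o)
    (hav : Avoids P M) : critRunCount P (i0, j0) M r ≤ P.n * P.n := by
  by_contra hcon
  have hav' : ∀ φ, ¬ IsEmbedding P M φ := fun φ hφ =>
    hav (minor_of_embedding (by omega) (by omega) φ hφ)
  obtain ⟨PB, T, B, hchain, hz⟩ := zone P M i0 o j0 r hi0 hj0 htwo hav'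
  have hfin := crit_finite P (i0, j0) M r
  unfold critRunCount at hcon
  rw [Set.ncard_eq_toFinset_card _ hfin] at hcon
  obtain ⟨f, hf1, hf2⟩ := enum_finset hfin.toFinset (P.n * P.n + 1) (by omega)
  have hf : ∀ t, ∃ c₂ c y, ∃ τ β : ℕ → ℕ, t ≤ P.n * P.n → ZeroRun M r (f t) c₂ ∧ f t ≤ c ∧ c ≤ c₂ ∧
      (∀ x, M.entry r x = true → T y x) ∧
      (Emb2 P.n M.n (fun j => P.entry i0 j = true) PB (fun x => T y x ∨ x = c) (B y) τ β ∧
            τ j0 = c) ∧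
      ∀ τ β, ¬ Emb2 P.n M.n (fun j => P.entry i0 j = true) PB (T y) (B y) τ β := by
    intro t
    by_cases ht : t ≤ P.n * P.n
    · have := hf1 t (by omega)
      rw [Set.Finite.mem_toFinset] at this
      obtain ⟨c₂, h1, c, h2, h3, h4⟩ := this
      obtain ⟨_, _, _, φ, hφ, hφc⟩ := h4
      obtain ⟨y, y1, ⟨τ, β, y2⟩, y3⟩ := hz c φ hφ hφc
      exact ⟨c₂, c, y, τ, β, fun _ => ⟨h1, h2, h3, y1, y2, y3⟩⟩
    · exact ⟨0, 0, 0, id, id, fun h => absurd h ht⟩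
  choose c₂ c y τ β hall using hf
  have hsep : ∀ t < P.n * P.n, c₂ t < f (t + 1) - 1 ∧ M.entry r (f (t + 1) - 1) = true := by
    intro t ht
    have h1 := (hall t ht.le).1
    have h2 := (hall (t + 1) ht).1
    have h3 := hf2 t (t + 1) (by omega) (by omega)
    have h4 : M.entry r (f (t + 1) - 1) = true := by
      rcases h2.2.2.2.2.1 with h | h
      · omega
      · exact h
    refine ⟨?_, h4⟩
    by_contra hc
    have := h1.2.2.2.1 (f (t + 1) - 1) (by omega) (by omega)
    rw [this] at h4
    exact absurd h4 (by simp)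
  refine core P.n M.n j0 (P.n * P.n) hj0 (fun j => P.entry i0 j = true) PB
    (fun t => T (y t)) (fun t => B (y t)) rfl c (fun t => f (t + 1) - 1) τ β ?_ ?_
    (chain_max B y hchain _) ?_ ?_
  · intro t ht
    have h1 := hall t ht.le
    have h2 := hall (t + 1) ht
    have h3 := hsep t ht
    have h4 := hf2 t (t + 1) (by omega) (by omega)
    exact ⟨by omega, by omega⟩
  · intro t ht s hs
    exact (hall t ht).2.2.2.1 _ (hsep s hs).2
  · intro t ht
    exact (hall t ht).2.2.2.2.1
  · intro t ht
    exact (hall t ht).2.2.2.2.2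

theorem run_extend (M : BMat) (r s : ℕ) (hr : r < M.m) (hs : s < M.n)
    (h0 : M.entry r s = false) (h1 : s = 0 ∨ M.entry r (s - 1) = true) :
    ∃ c₂, ZeroRun M r s c₂ := by
  classical
  have hex : ∃ k, s < k ∧ (k = M.n ∨ M.entry r k = true) := ⟨M.n, hs, Or.inl rfl⟩
  have hspec := Nat.find_spec hex
  have hmin := fun k => Nat.find_min (m := k) hex
  have hle : Nat.find hex ≤ M.n := Nat.find_min' hex ⟨hs, Or.inl rfl⟩
  set k := Nat.find hex
  refine ⟨k - 1, hr, by omega, by omega, ?_, h1, ?_⟩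
  · intro j hj hj'
    by_cases hjs : j = s
    · subst hjs; exact h0
    · have := hmin j (by omega)
      by_contra hne
      exact this ⟨by omega, Or.inr (by simpa using hne)⟩
  · rw [show k - 1 + 1 = k by omega]
    exact hspec.2

/-- **Lemma.** If `P ∈ {0,1}^{k×ℓ}` has at most two nonempty rows, then `P`
is row-bounding; in fact for every 1-entry `e` of `P`, every row of every
`P`-avoiding matrix contains at most `ℓ²` 0-runs critical for `e`. -/
theorem stmt_13 (P : BMat)
    (htwo : ∃ a b, ∀ i j, i < P.m → j < P.n → P.entry i j = true →
      i = a ∨ i = b) :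
    RowBounded (Av P) ∧
      ∀ i j, i < P.m → j < P.n → P.entry i j = true →
        ∀ M, Avoids P M → ∀ r, critRunCount P (i, j) M r ≤ P.n * P.n := by
  obtain ⟨a, b, hab⟩ := htwo
  have main : ∀ i j, i < P.m → j < P.n → P.entry i j = true →
        ∀ M, Avoids P M → ∀ r, critRunCount P (i, j) M r ≤ P.n * P.n := by
    intro i j hi hj hP M hM r
    rcases hab i j hi hj hP with h | h
    · subst h
      exact crit_bound P M i b j r hi hj hab hM
    · subst h
      exact crit_bound P M i a j r hi hj (fun i' j' h1 h2 h3 => (hab i' j' h1 h2 h3).symm) hM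
  refine ⟨?_, main⟩
  classical
  refine ⟨(P.m * P.n) * (P.n * P.n), ?_⟩
  intro M hM r hr
  obtain ⟨hMav, hMc⟩ := hM
  set E : Finset (ℕ × ℕ) := ((Finset.range P.m) ×ˢ (Finset.range P.n)).filter
    (fun e => P.entry e.1 e.2 = true) with hE
  have hEm : ∀ e ∈ E, e.1 < P.m ∧ e.2 < P.n ∧ P.entry e.1 e.2 = true := by
    intro e he
    simpa [hE, and_assoc] using he
  unfold rowRunCount
  have hsub : {j | j < M.n ∧ M.entry r j = false ∧ (j = 0 ∨ M.entry r (j - 1) = true)} ⊆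
      ((E.biUnion (fun e => (crit_finite P e M r).toFinset) : Finset ℕ) : Set ℕ) := by
    rintro s ⟨hs, h0, h1⟩
    obtain ⟨c₂, hrun⟩ := run_extend M r s hr hs h0 h1
    have hnot := hMc r s hr hs h0
    have hmin : IntervalMinor P (setOne M r s) := by
      by_contra h
      exact hnot h
    have hpm : 0 < P.m := by
      obtain ⟨g, h, hg, hh, _⟩ := minor2_of_minor hmin
      have := hg.1 r hr
      omega
    have hpn : 0 < P.n := by
      obtain ⟨g, h, hg, hh, _⟩ := minor2_of_minor hmin
      have := hh.1 s hs
      omega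
    obtain ⟨φ, hφ⟩ := embedding_of_minor hmin
    have hhit : ∃ i j, i < P.m ∧ j < P.n ∧ P.entry i j = true ∧ φ i j = (r, s) := by
      by_contra hcon
      push Not at hcon
      apply hMav
      refine minor_of_embedding hpm hpn φ ⟨hφ.1, ?_, hφ.2.2⟩
      intro i j hi hj hP
      have h2 := hφ.2.1 i j hi hj hP
      simp only [setOne] at h2
      split_ifs at h2 with h3
      · exact absurd (Prod.ext h3.1 h3.2) (hcon i j hi hj hP)
      · exact h2
    obtain ⟨i, j, hi, hj, hP, hφe⟩ := hhit
    rw [Finset.mem_coe, Finset.mem_biUnion]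
    refine ⟨(i, j), ?_, ?_⟩
    · simp [hE, hi, hj, hP]
    · rw [Set.Finite.mem_toFinset]
      exact ⟨c₂, hrun, s, le_rfl, hrun.2.1, hr, hs, h0, φ, hφ, hφe⟩
  refine (Set.ncard_le_ncard hsub (Finset.finite_toSet _)).trans ?_
  rw [Set.ncard_coe_finset]
  refine (Finset.card_biUnion_le_card_mul _ _ (P.n * P.n) ?_).trans ?_
  · intro e he
    obtain ⟨h1, h2, h3⟩ := hEm e he
    have := main e.1 e.2 h1 h2 h3 M hMav r
    unfold critRunCount at this
    rw [Set.ncard_eq_toFinset_card _ (crit_finite P e M r)] at this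
    exact this
  · apply Nat.mul_le_mul_right
    calc E.card ≤ ((Finset.range P.m) ×ˢ (Finset.range P.n)).card := Finset.card_filter_le _ _
      _ = P.m * P.n := by simp
end

section
/- If all the 1-entries of a pattern P ∈ {0,1}^{k×ℓ} can be covered by one row and one column (i.e., there exist a row r and a column c such that every 1-entry of P lies in row r or in column c), then P is row-bounding. -/
open BMat

namespace BMat

lemma strict_aux {ρ : ℕ → ℕ} {k : ℕ} (h : ∀ i, i < k → ρ i < ρ (i + 1)) :
    ∀ i j, i < j → j ≤ k → ρ i < ρ j := by
  intro i j hij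
  induction j with
  | zero => omega
  | succ j ih =>
    intro hj
    have h1 := h j (by omega)
    rcases Nat.lt_or_ge i j with h2 | h2
    · have := ih h2 (by omega)
      omega
    · have : i = j := by omega
      subst this
      exact h1

lemma le_aux {ρ : ℕ → ℕ} {k : ℕ} (h : ∀ i, i < k → ρ i < ρ (i + 1)) :
    ∀ i j, i ≤ j → j ≤ k → ρ i ≤ ρ j := by
  intro i j hij hj
  rcases Nat.lt_or_ge i j with h2 | h2
  · exact (strict_aux h i j h2 hj).le
  · have : i = j := by omega
    rw [this]

lemma cell_unique {ρ : ℕ → ℕ} {k : ℕ} (h : ∀ i, i < k → ρ i < ρ (i + 1))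
    {i j t : ℕ} (hi : i < k) (hj : j < k) (h1 : ρ i ≤ t) (h2 : t < ρ (i + 1))
    (h3 : ρ j ≤ t) (h4 : t < ρ (j + 1)) : i = j := by
  rcases Nat.lt_trichotomy i j with h5 | h5 | h5
  · have := le_aux h (i + 1) j h5 (by omega)
    omega
  · exact h5
  · have := le_aux h (j + 1) i h5 (by omega)
    omega

lemma dims_le {M M' : BMat} (h : Relation.ReflTransGen Con M M') :
    (M'.m ≤ M.m ∧ M'.n ≤ M.n) ∧ (M'.m = 0 → M.m = 0) ∧ (M'.n = 0 → M.n = 0) := by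
  induction h with
  | refl => simp
  | tail _ h2 ih =>
    rcases h2 with ⟨q, h1, h2, h3, -⟩ | ⟨q, h1, h2, h3, -⟩ <;>
    · refine ⟨⟨by omega, by omega⟩, fun h => ?_, fun h => ?_⟩ <;> omega

/-- contraction step, rows -/
lemma part_of_rowCon {M M' P : BMat} (h : RowCon M M') (hp : PartitionContains M' P) :
    PartitionContains M P := by
  obtain ⟨q, hq, hm, hn, he⟩ := h
  obtain ⟨ρ, κ, h1, h2, h3, h4, h5⟩ := hp
  refine ⟨fun i => if ρ i ≤ q then ρ i else ρ i + 1, κ, ?_, h2, ?_, by omega, ?_⟩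
  · intro i hi
    have := h1 i hi
    dsimp only
    split_ifs <;> omega
  · dsimp only
    split_ifs <;> omega
  · intro i j hi hj hij
    obtain ⟨a, b, ha1, ha2, hb1, hb2, hab⟩ := h5 i j hi hj hij
    have l1 := le_aux h1 (i + 1) P.m hi le_rfl
    have l2 := le_aux h2 (j + 1) P.n hj le_rfl
    rw [he a b (by omega) (by omega)] at hab
    dsimp only
    by_cases c1 : a < q
    · rw [if_pos c1] at hab
      exact ⟨a, b, by split_ifs <;> omega, by split_ifs <;> omega, hb1, hb2, hab⟩
    · rw [if_neg c1] at hab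
      by_cases c2 : a = q
      · rw [if_pos c2, Bool.or_eq_true] at hab
        rcases hab with hab | hab
        · exact ⟨q, b, by split_ifs <;> omega, by split_ifs <;> omega, hb1, hb2, hab⟩
        · exact ⟨q + 1, b, by split_ifs <;> omega, by split_ifs <;> omega, hb1, hb2, hab⟩
      · rw [if_neg c2] at hab
        exact ⟨a + 1, b, by split_ifs <;> omega, by split_ifs <;> omega, hb1, hb2, hab⟩

lemma part_of_colCon {M M' P : BMat} (h : ColCon M M') (hp : PartitionContains M' P) :
    PartitionContains M P := by
  obtain ⟨q, hq, hm, hn, he⟩ := h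
  obtain ⟨ρ, κ, h1, h2, h3, h4, h5⟩ := hp
  refine ⟨ρ, fun i => if κ i ≤ q then κ i else κ i + 1, h1, ?_, by omega, ?_, ?_⟩
  · intro i hi
    have := h2 i hi
    dsimp only
    split_ifs <;> omega
  · dsimp only
    split_ifs <;> omega
  · intro i j hi hj hij
    obtain ⟨a, b, ha1, ha2, hb1, hb2, hab⟩ := h5 i j hi hj hij
    have l1 := le_aux h1 (i + 1) P.m hi le_rfl
    have l2 := le_aux h2 (j + 1) P.n hj le_rfl
    rw [he a b (by omega) (by omega)] at hab
    dsimp only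
    by_cases c1 : b < q
    · rw [if_pos c1] at hab
      exact ⟨a, b, ha1, ha2, by split_ifs <;> omega, by split_ifs <;> omega, hab⟩
    · rw [if_neg c1] at hab
      by_cases c2 : b = q
      · rw [if_pos c2, Bool.or_eq_true] at hab
        rcases hab with hab | hab
        · exact ⟨a, q, ha1, ha2, by split_ifs <;> omega, by split_ifs <;> omega, hab⟩
        · exact ⟨a, q + 1, ha1, ha2, by split_ifs <;> omega, by split_ifs <;> omega, hab⟩
      · rw [if_neg c2] at hab
        exact ⟨a, b + 1, ha1, ha2, by split_ifs <;> omega, by split_ifs <;> omega, hab⟩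

lemma part_of_minor {M P : BMat} (h : IntervalMinor P M) : PartitionContains M P := by
  obtain ⟨M', h1, h2, h3, h4⟩ := h
  induction h1 using Relation.ReflTransGen.head_induction_on with
  | refl =>
    refine ⟨fun i => i, fun i => i, by simp, by simp, by simp [h2], by simp [h3], ?_⟩
    intro i j hi hj hij
    exact ⟨i, j, by simp, by simp, by simp, by simp, h4 i j hi hj hij⟩
  | head h1 _ ih =>
    rcases h1 with h1 | h1
    · exact part_of_rowCon h1 ih
    · exact part_of_colCon h1 ih

lemma gap_aux {ρ : ℕ → ℕ} {k m : ℕ} (h : ∀ i, i < k → ρ i < ρ (i + 1)) (h0 : ρ 0 = 0)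
    (hk : ρ k = m) (hne : m ≠ k) : ∃ i, i < k ∧ ρ i + 1 < ρ (i + 1) := by
  by_contra hc
  push Not at hc
  have : ∀ i, i ≤ k → ρ i = i := by
    intro i
    induction i with
    | zero => intro _; exact h0
    | succ i ih =>
      intro hi
      have := ih (by omega)
      have := h i (by omega)
      have := hc i (by omega)
      omega
  have := this k le_rfl
  omega

lemma id_aux {ρ : ℕ → ℕ} {k : ℕ} (h : ∀ i, i < k → ρ i < ρ (i + 1)) (h0 : ρ 0 = 0)
    (hk : ρ k = k) : ∀ i, i ≤ k → ρ i = i := by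
  have h1 : ∀ i, i ≤ k → i ≤ ρ i := by
    intro i
    induction i with
    | zero => omega
    | succ i ih =>
      intro hi
      have := ih (by omega)
      have := h i (by omega)
      omega
  have h2 : ∀ d, d ≤ k → ρ (k - d) ≤ k - d := by
    intro d
    induction d with
    | zero => simp [hk]
    | succ d ih =>
      intro hd
      have := ih (by omega)
      have := h (k - (d + 1)) (by omega)
      have e : k - (d + 1) + 1 = k - d := by omega
      rw [e] at this
      omega
  intro i hi
  have a := h1 i hi
  have b := h2 (k - i) (by omega)
  have e : k - (k - i) = i := by omega
  rw [e] at b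
  omega

lemma rows_contract (k : ℕ) : ∀ (m : ℕ) (M : BMat) (ρ : ℕ → ℕ), M.m = m →
    (∀ i, i < k → ρ i < ρ (i + 1)) → ρ 0 = 0 → ρ k = m →
    ∃ M', Relation.ReflTransGen Con M M' ∧ M'.m = k ∧ M'.n = M.n ∧
      ∀ i j a, i < k → j < M.n → ρ i ≤ a → a < ρ (i + 1) → M.entry a j = true →
        M'.entry i j = true := by
  intro m
  induction m with
  | zero =>
    intro M ρ hM h h0 hk
    have : k = 0 := by
      by_contra hne
      have := strict_aux h 0 k (by omega) le_rfl
      omega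
    subst this
    exact ⟨M, .refl, hM, rfl, fun i j a hi => by omega⟩
  | succ m ih =>
    intro M ρ hM h h0 hk
    by_cases hmk : m + 1 = k
    · refine ⟨M, .refl, by omega, rfl, ?_⟩
      intro i j a hi hj h1 h2 h3
      have e := id_aux h h0 (by omega)
      rw [e i (by omega)] at h1
      rw [e (i + 1) (by omega)] at h2
      have : a = i := by omega
      rwa [← this]
    · obtain ⟨q, hq, hgap⟩ := gap_aux h h0 hk hmk
      have l1 := le_aux h (q + 1) k hq le_rfl
      let M1 : BMat := ⟨m, M.n, fun i j => if i < ρ q then M.entry i j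
        else if i = ρ q then (M.entry (ρ q) j || M.entry (ρ q + 1) j)
        else M.entry (i + 1) j⟩
      have hcon : Con M M1 := Or.inl ⟨ρ q, by omega, by simp [M1, hM], rfl,
        fun i j _ _ => rfl⟩
      let ρ' : ℕ → ℕ := fun i => if i ≤ q then ρ i else ρ i - 1
      have hle : ∀ i, i ≤ q → ρ i ≤ ρ q := fun i hi => le_aux h i q hi (by omega)
      have hge : ∀ i, q < i → i ≤ k → ρ q + 2 ≤ ρ i := fun i hi hik => by
        have := le_aux h (q + 1) i hi hik
        omega
      obtain ⟨M', g1, g2, g3, g4⟩ := ih M1 ρ' rfl (by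
          intro i hi
          have := h i hi
          simp only [ρ']
          split_ifs with c1 c2 c2
          · omega
          · have : i = q := by omega
            subst this; omega
          · omega
          · have := hge i (by omega) (by omega)
            omega) (by simp [ρ', h0]) (by simp [ρ']; rw [if_neg (by omega)]; omega)
      refine ⟨M', .head hcon g1, g2, g3, ?_⟩
      intro i j a hi hj h1 h2 h3
      have f1 := hle i
      have f2 := hle (i + 1)
      have f3 := hge i
      have f4 := hge (i + 1)
      by_cases c1 : a ≤ ρ q
      · refine g4 i j a hi hj ?_ ?_ ?_
        · simp only [ρ']; split_ifs <;> omega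
        · simp only [ρ']
          split_ifs
          · omega
          · have := f4 (by omega) (by omega)
            omega
        · simp only [M1]
          split_ifs with d1 d2
          · exact h3
          · rw [← d2, h3]; simp
          · omega
      · refine g4 i j (a - 1) hi hj ?_ ?_ ?_
        · simp only [ρ']; split_ifs <;> omega
        · simp only [ρ']
          split_ifs
          · have := f2 (by omega)
            omega
          · omega
        · simp only [M1]
          rw [if_neg (by omega)]
          split_ifs with d2
          · have : ρ q + 1 = a := by omega
            rw [this, h3]; simp
          · have : a - 1 + 1 = a := by omega
            rw [this, h3]

lemma cols_contract (k : ℕ) : ∀ (m : ℕ) (M : BMat) (ρ : ℕ → ℕ), M.n = m →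
    (∀ i, i < k → ρ i < ρ (i + 1)) → ρ 0 = 0 → ρ k = m →
    ∃ M', Relation.ReflTransGen Con M M' ∧ M'.n = k ∧ M'.m = M.m ∧
      ∀ i j a, i < k → j < M.m → ρ i ≤ a → a < ρ (i + 1) → M.entry j a = true →
        M'.entry j i = true := by
  intro m
  induction m with
  | zero =>
    intro M ρ hM h h0 hk
    have : k = 0 := by
      by_contra hne
      have := strict_aux h 0 k (by omega) le_rfl
      omega
    subst this
    exact ⟨M, .refl, hM, rfl, fun i j a hi => by omega⟩
  | succ m ih =>
    intro M ρ hM h h0 hk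
    by_cases hmk : m + 1 = k
    · refine ⟨M, .refl, by omega, rfl, ?_⟩
      intro i j a hi hj h1 h2 h3
      have e := id_aux h h0 (by omega)
      rw [e i (by omega)] at h1
      rw [e (i + 1) (by omega)] at h2
      have : a = i := by omega
      rwa [← this]
    · obtain ⟨q, hq, hgap⟩ := gap_aux h h0 hk hmk
      have l1 := le_aux h (q + 1) k hq le_rfl
      let M1 : BMat := ⟨M.m, m, fun j i => if i < ρ q then M.entry j i
        else if i = ρ q then (M.entry j (ρ q) || M.entry j (ρ q + 1))
        else M.entry j (i + 1)⟩
      have hcon : Con M M1 := Or.inr ⟨ρ q, by omega, by simp [M1, hM], rfl,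
        fun i j _ _ => rfl⟩
      let ρ' : ℕ → ℕ := fun i => if i ≤ q then ρ i else ρ i - 1
      have hle : ∀ i, i ≤ q → ρ i ≤ ρ q := fun i hi => le_aux h i q hi (by omega)
      have hge : ∀ i, q < i → i ≤ k → ρ q + 2 ≤ ρ i := fun i hi hik => by
        have := le_aux h (q + 1) i hi hik
        omega
      obtain ⟨M', g1, g2, g3, g4⟩ := ih M1 ρ' rfl (by
          intro i hi
          have := h i hi
          simp only [ρ']
          split_ifs with c1 c2 c2
          · omega
          · have : i = q := by omega
            subst this; omega
          · omega
          · have := hge i (by omega) (by omega)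
            omega) (by simp [ρ', h0]) (by simp [ρ']; rw [if_neg (by omega)]; omega)
      refine ⟨M', .head hcon g1, g2, g3, ?_⟩
      intro i j a hi hj h1 h2 h3
      have f1 := hle i
      have f2 := hle (i + 1)
      have f3 := hge i
      have f4 := hge (i + 1)
      by_cases c1 : a ≤ ρ q
      · refine g4 i j a hi hj ?_ ?_ ?_
        · simp only [ρ']; split_ifs <;> omega
        · simp only [ρ']
          split_ifs
          · omega
          · have := f4 (by omega) (by omega)
            omega
        · simp only [M1]
          split_ifs with d1 d2
          · exact h3
          · rw [← d2, h3]; simp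
          · omega
      · refine g4 i j (a - 1) hi hj ?_ ?_ ?_
        · simp only [ρ']; split_ifs <;> omega
        · simp only [ρ']
          split_ifs
          · have := f2 (by omega)
            omega
          · omega
        · simp only [M1]
          rw [if_neg (by omega)]
          split_ifs with d2
          · have : ρ q + 1 = a := by omega
            rw [this, h3]; simp
          · have : a - 1 + 1 = a := by omega
            rw [this, h3]

/-- Normalising a partition sequence so that it starts at `0` and ends at `m`. -/
lemma normalise {ρ : ℕ → ℕ} {k m : ℕ} (hk : 0 < k) (h : ∀ i, i < k → ρ i < ρ (i + 1))
    (hm : ρ k ≤ m) : ∃ ρ' : ℕ → ℕ, (∀ i, i < k → ρ' i < ρ' (i + 1)) ∧ ρ' 0 = 0 ∧ ρ' k = m ∧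
      ∀ i, i < k → ρ' i ≤ ρ i ∧ ρ (i + 1) ≤ ρ' (i + 1) := by
  refine ⟨fun i => if i = 0 then 0 else if i = k then m else ρ i, ?_, by simp, ?_, ?_⟩
  · intro i hi
    have := h i hi
    dsimp only
    rw [if_neg (show ¬ i + 1 = 0 by omega)]
    by_cases e : i + 1 = k
    · rw [if_pos e]
      rw [e] at this
      split_ifs <;> omega
    · rw [if_neg e]
      split_ifs <;> omega
  · dsimp only
    rw [if_neg (by omega), if_pos rfl]
  · intro i hi
    dsimp only
    constructor
    · split_ifs <;> omega
    · rw [if_neg (by omega)]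
      split_ifs with c1
      · rw [c1]; exact hm
      · exact le_rfl

lemma minor_of_part {M P : BMat} (hm : 0 < P.m) (hn : 0 < P.n) (h : PartitionContains M P) :
    IntervalMinor P M := by
  obtain ⟨ρ, κ, h1, h2, h3, h4, h5⟩ := h
  obtain ⟨ρ', r1, r2, r3, r4⟩ := normalise hm h1 h3
  obtain ⟨κ', k1, k2, k3, k4⟩ := normalise hn h2 h4
  obtain ⟨M1, a1, a2, a3, a4⟩ := rows_contract P.m M.m M ρ' rfl r1 r2 r3
  obtain ⟨M2, b1, b2, b3, b4⟩ := cols_contract P.n M.n M1 κ' a3 k1 k2 k3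
  refine ⟨M2, a1.trans b1, by omega, b2, ?_⟩
  intro i j hi hj hij
  obtain ⟨a, b, ha1, ha2, hb1, hb2, hab⟩ := h5 i j hi hj hij
  have := r4 i hi
  have := k4 j hj
  have := le_aux k1 (j + 1) P.n hj le_rfl
  exact b4 j i b hj (by omega) (by omega) (by omega)
    (a4 i b a hi (by omega) (by omega) (by omega) hab)

/-- Partition of `M` realising every 1-entry of `P` except possibly `(i,j)`. -/
def NearPart (M P : BMat) (i j : ℕ) (ρ κ : ℕ → ℕ) : Prop :=
  (∀ i, i < P.m → ρ i < ρ (i + 1)) ∧ (∀ j, j < P.n → κ j < κ (j + 1)) ∧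
    ρ P.m ≤ M.m ∧ κ P.n ≤ M.n ∧
    ∀ i' j', i' < P.m → j' < P.n → P.entry i' j' = true → ¬ (i' = i ∧ j' = j) →
      ∃ a b, ρ i' ≤ a ∧ a < ρ (i' + 1) ∧ κ j' ≤ b ∧ b < κ (j' + 1) ∧
        M.entry a b = true

lemma near_of_setOne {M P : BMat} {t x : ℕ} (hM : ¬ PartitionContains M P)
    (h : PartitionContains (setOne M t x) P) :
    ∃ i j ρ κ, i < P.m ∧ j < P.n ∧ P.entry i j = true ∧ NearPart M P i j ρ κ ∧
      ρ i ≤ t ∧ t < ρ (i + 1) ∧ κ j ≤ x ∧ x < κ (j + 1) := by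
  obtain ⟨ρ, κ, h1, h2, h3, h4, h5⟩ := h
  by_contra hc
  apply hM
  by_cases hex : ∃ i j, i < P.m ∧ j < P.n ∧ P.entry i j = true ∧
      ρ i ≤ t ∧ t < ρ (i + 1) ∧ κ j ≤ x ∧ x < κ (j + 1)
  · exfalso
    apply hc
    obtain ⟨i, j, hi, hj, hij, c1, c2, c3, c4⟩ := hex
    refine ⟨i, j, ρ, κ, hi, hj, hij, ⟨h1, h2, h3, h4, ?_⟩, c1, c2, c3, c4⟩
    intro i' j' hi' hj' hij' hne
    obtain ⟨a, b, ha1, ha2, hb1, hb2, hab⟩ := h5 i' j' hi' hj' hij'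
    refine ⟨a, b, ha1, ha2, hb1, hb2, ?_⟩
    simp only [setOne] at hab
    split_ifs at hab with hh
    · exfalso
      apply hne
      obtain ⟨rfl, rfl⟩ := hh
      exact ⟨cell_unique h1 hi' hi ha1 ha2 c1 c2, cell_unique h2 hj' hj hb1 hb2 c3 c4⟩
    · exact hab
  · refine ⟨ρ, κ, h1, h2, h3, h4, ?_⟩
    intro i' j' hi' hj' hij'
    obtain ⟨a, b, ha1, ha2, hb1, hb2, hab⟩ := h5 i' j' hi' hj' hij'
    refine ⟨a, b, ha1, ha2, hb1, hb2, ?_⟩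
    simp only [setOne] at hab
    split_ifs at hab with hh
    · exfalso
      apply hex
      obtain ⟨rfl, rfl⟩ := hh
      exact ⟨i', j', hi', hj', hij', ha1, ha2, hb1, hb2⟩
    · exact hab

lemma merge {ρ₁ ρ₂ : ℕ → ℕ} {k m r : ℕ} (h1 : ∀ i, i < k → ρ₁ i < ρ₁ (i + 1))
    (h2 : ∀ i, i < k → ρ₂ i < ρ₂ (i + 1)) (m1 : ρ₁ k ≤ m) (m2 : ρ₂ k ≤ m) (hr : r < k) :
    ∃ ρ : ℕ → ℕ, (∀ i, i < k → ρ i < ρ (i + 1)) ∧ ρ k ≤ m ∧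
      (∀ q, q < k → (ρ q ≤ ρ₁ q ∧ ρ₁ (q + 1) ≤ ρ (q + 1)) ∨
        (ρ q ≤ ρ₂ q ∧ ρ₂ (q + 1) ≤ ρ (q + 1))) ∧
      (ρ r ≤ ρ₁ r ∧ ρ₁ (r + 1) ≤ ρ (r + 1)) ∧ (ρ r ≤ ρ₂ r ∧ ρ₂ (r + 1) ≤ ρ (r + 1)) := by
  have e1 := h1 r hr
  have e2 := h2 r hr
  refine ⟨fun q => if q ≤ r then (if ρ₁ r ≤ ρ₂ r then ρ₁ q else ρ₂ q)
    else (if ρ₂ (r + 1) ≤ ρ₁ (r + 1) then ρ₁ q else ρ₂ q), ?_, ?_, ?_, ?_, ?_⟩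
  · intro i hi
    have a1 := h1 i hi
    have a2 := h2 i hi
    dsimp only
    rcases Nat.lt_trichotomy i r with hir | hir | hir
    · split_ifs <;> omega
    · subst hir
      split_ifs <;> omega
    · split_ifs <;> omega
  · dsimp only
    rw [if_neg (by omega)]
    split_ifs <;> omega
  · intro i hi
    dsimp only
    rcases Nat.lt_trichotomy i r with hir | hir | hir
    · split_ifs <;> omega
    · subst hir
      split_ifs <;> omega
    · split_ifs <;> omega
  · dsimp only
    split_ifs <;> omega
  · dsimp only
    split_ifs <;> omega

lemma fuse {M P : BMat} {r c i t x₁ x₂ y : ℕ} {ρ₁ κ₁ ρ₂ κ₂ : ℕ → ℕ}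
    (hcov : ∀ i j, i < P.m → j < P.n → P.entry i j = true → i = r ∨ j = c)
    (hr : r < P.m) (hc : c < P.n) (hi : i < P.m)
    (n1 : NearPart M P i c ρ₁ κ₁) (n2 : NearPart M P i c ρ₂ κ₂)
    (a1 : ρ₁ i ≤ t ∧ t < ρ₁ (i + 1)) (a2 : ρ₂ i ≤ t ∧ t < ρ₂ (i + 1))
    (b1 : κ₁ c ≤ x₁) (b2 : x₂ < κ₂ (c + 1))
    (hy1 : x₁ ≤ y) (hy2 : y ≤ x₂) (hy : M.entry t y = true) :
    PartitionContains M P := by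
  obtain ⟨p1, p2, p3, p4, p5⟩ := n1
  obtain ⟨q1, q2, q3, q4, q5⟩ := n2
  obtain ⟨ρ, r1, r2, r3, r4, r5⟩ := merge p1 q1 p3 q3 hr
  obtain ⟨κ, k1, k2, k3, k4, k5⟩ := merge p2 q2 p4 q4 hc
  refine ⟨ρ, κ, r1, k1, r2, k2, ?_⟩
  intro i' j' hi' hj' hij'
  by_cases hh : i' = i ∧ j' = c
  · obtain ⟨rfl, rfl⟩ := hh
    have := r3 i' hi'
    exact ⟨t, y, by omega, by omega, by omega, by omega, hy⟩
  · obtain ⟨s1, s2, s3, s4, s5, s6, s7⟩ := p5 i' j' hi' hj' hij' hh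
    obtain ⟨t1, t2, t3, t4, t5, t6, t7⟩ := q5 i' j' hi' hj' hij' hh
    rcases hcov i' j' hi' hj' hij' with rfl | rfl
    · rcases k3 j' hj' with d | d
      · exact ⟨s1, s2, by omega, by omega, by omega, by omega, s7⟩
      · exact ⟨t1, t2, by omega, by omega, by omega, by omega, t7⟩
    · rcases r3 i' hi' with d | d
      · exact ⟨s1, s2, by omega, by omega, by omega, by omega, s7⟩
      · exact ⟨t1, t2, by omega, by omega, by omega, by omega, t7⟩

lemma left_case {M P : BMat} {r c j t x : ℕ} {ρ κ y : ℕ → ℕ}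
    (hcov : ∀ i j, i < P.m → j < P.n → P.entry i j = true → i = r ∨ j = c)
    (hj : j < c) (n : NearPart M P r j ρ κ)
    (a : ρ r ≤ t ∧ t < ρ (r + 1)) (b : x < κ (j + 1))
    (hy : ∀ q, q < j → y q < y (q + 1)) (hyx : y j < x)
    (h1 : ∀ q, q ≤ j → M.entry t (y q) = true) (hjn : j < P.n) :
    PartitionContains M P := by
  obtain ⟨p1, p2, p3, p4, p5⟩ := n
  have hstep : ∀ q, q ≤ j → y q < (if q + 1 ≤ j then y (q + 1) else κ (q + 1)) := by
    intro q hq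
    split_ifs with c1
    · exact hy q (by omega)
    · have : q = j := by omega
      subst this; omega
  refine ⟨ρ, fun q => if q ≤ j then y q else κ q, p1, ?_, p3, ?_, ?_⟩
  · intro q hq
    dsimp only
    by_cases c1 : q ≤ j
    · rw [if_pos c1]; exact hstep q c1
    · rw [if_neg c1, if_neg (by omega)]; exact p2 q hq
  · dsimp only
    rw [if_neg (by omega)]; exact p4
  · intro i' j' hi' hj' hij'
    dsimp only
    by_cases c1 : j' ≤ j
    · rcases hcov i' j' hi' hj' hij' with rfl | h
      · rw [if_pos c1]
        exact ⟨t, y j', a.1, a.2, le_rfl, hstep j' c1, h1 j' c1⟩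
      · omega
    · rw [if_neg c1, if_neg (by omega)]
      exact p5 i' j' hi' hj' hij' (by omega)

lemma right_case {M P : BMat} {r c j t x : ℕ} {ρ κ y : ℕ → ℕ}
    (hcov : ∀ i j, i < P.m → j < P.n → P.entry i j = true → i = r ∨ j = c)
    (hj : c < j) (n : NearPart M P r j ρ κ)
    (a : ρ r ≤ t ∧ t < ρ (r + 1)) (b : κ j ≤ x)
    (hy : ∀ q, q + 1 < P.n → y q < y (q + 1)) (hyx : x < y j)
    (h1 : ∀ q, q < P.n → M.entry t (y q) = true) (hjn : j < P.n)
    (hyn : y (P.n - 1) < M.n) :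
    PartitionContains M P := by
  obtain ⟨p1, p2, p3, p4, p5⟩ := n
  have hstep : ∀ q, j ≤ q → q < P.n → (if q ≤ j then κ q else y (q - 1) + 1) ≤ y q := by
    intro q hq hqn
    split_ifs with c1
    · have : q = j := by omega
      subst this; omega
    · have := hy (q - 1) (by omega)
      have e : q - 1 + 1 = q := by omega
      rw [e] at this
      omega
  refine ⟨ρ, fun q => if q ≤ j then κ q else y (q - 1) + 1, p1, ?_, p3, ?_, ?_⟩
  · intro q hq
    dsimp only
    by_cases c1 : q < j
    · rw [if_pos (by omega), if_pos (by omega)]; exact p2 q hq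
    · have := hstep q (by omega) hq
      rw [if_neg (show ¬ q + 1 ≤ j by omega)]
      simp only [Nat.add_sub_cancel]
      omega
  · dsimp only
    rw [if_neg (by omega)]; omega
  · intro i' j' hi' hj' hij'
    dsimp only
    by_cases c1 : j' < j
    · rw [if_pos (by omega), if_pos (by omega)]
      exact p5 i' j' hi' hj' hij' (by omega)
    · rcases hcov i' j' hi' hj' hij' with rfl | h
      · refine ⟨t, y j', a.1, a.2, hstep j' (by omega) hj', ?_, h1 j' hj'⟩
        rw [if_neg (by omega)]
        simp
      · omega

lemma bound_aux {M P : BMat} {r c t : ℕ}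
    (hcov : ∀ i j, i < P.m → j < P.n → P.entry i j = true → i = r ∨ j = c)
    (hr : r < P.m) (hM : ¬ PartitionContains M P)
    (hcrit : ∀ x, x < M.n → M.entry t x = false → PartitionContains (setOne M t x) P)
    (s : ℕ → ℕ) (hs : ∀ u, u < 2 * P.n + P.m → s u < s (u + 1))
    (hz : ∀ u, u ≤ 2 * P.n + P.m → s u < M.n ∧ M.entry t (s u) = false ∧
      (s u = 0 ∨ M.entry t (s u - 1) = true)) : False := by
  -- ones
  have hone : ∀ u, u < 2 * P.n + P.m →
      M.entry t (s (u + 1) - 1) = true ∧ s u < s (u + 1) - 1 ∧ s (u + 1) - 1 < s (u + 1) := by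
    intro u hu
    have h1 := hs u hu
    have h2 := (hz (u + 1) (by omega)).2.2
    have h3 := (hz u (by omega)).2.1
    have h4 : M.entry t (s (u + 1) - 1) = true := by
      rcases h2 with h2 | h2
      · omega
      · exact h2
    refine ⟨h4, ?_, by omega⟩
    by_contra hc
    have : s (u + 1) - 1 = s u := by omega
    rw [this, h3] at h4
    cases h4
  have key : ∀ u, P.n ≤ u → u ≤ P.n + P.m → ∃ i ρ κ, i < P.m ∧ c < P.n ∧
      NearPart M P i c ρ κ ∧ ρ i ≤ t ∧ t < ρ (i + 1) ∧ κ c ≤ s u ∧ s u < κ (c + 1) := by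
    intro u hu1 hu2
    obtain ⟨z1, z2, -⟩ := hz u (by omega)
    obtain ⟨i, j, ρ, κ, hi, hj, hij, n, a1, a2, b1, b2⟩ := near_of_setOne hM (hcrit _ z1 z2)
    rcases Nat.lt_trichotomy j c with hjc | hjc | hjc
    · exfalso
      rcases hcov i j hi hj hij with rfl | h
      · apply hM
        refine left_case (y := fun q => s (q + 1) - 1) hcov hjc n ⟨a1, a2⟩ b2 ?_ ?_ ?_ hj
        · intro q hq
          have := hone q (by omega)
          have := hone (q + 1) (by omega)
          omega
        · have := hone j (by omega)
          have := le_aux hs (j + 1) u (by omega) (by omega)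
          omega
        · intro q hq
          exact (hone q (by omega)).1
      · omega
    · subst hjc
      exact ⟨i, ρ, κ, hi, hj, n, a1, a2, b1, b2⟩
    · exfalso
      rcases hcov i j hi hj hij with rfl | h
      · apply hM
        refine right_case (y := fun q => s (P.n + P.m + q + 1) - 1) hcov hjc n ⟨a1, a2⟩ b1
          ?_ ?_ ?_ hj ?_
        · intro q hq
          have := hone (P.n + P.m + q) (by omega)
          have := hone (P.n + P.m + (q + 1)) (by omega)
          have e : P.n + P.m + (q + 1) = P.n + P.m + q + 1 := by omega
          simp only [e] at *
          omega
        · have := hone (P.n + P.m + j) (by omega)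
          have := le_aux hs u (P.n + P.m + j) (by omega) (by omega)
          omega
        · intro q hq
          exact (hone (P.n + P.m + q) (by omega)).1
        · have := (hz (P.n + P.m + (P.n - 1) + 1) (by omega)).1
          omega
      · omega
  choose! I R Kp hI using key
  obtain ⟨u, hu, v, hv, huv, huv2⟩ := Finset.exists_ne_map_eq_of_card_lt_of_maps_to
    (s := Finset.Icc P.n (P.n + P.m)) (t := Finset.range P.m) (f := I)
    (by rw [Nat.card_Icc, Finset.card_range]; omega) (by
      intro u hu
      simp only [Finset.coe_Icc, Set.mem_Icc] at hu
      simpa using (hI u hu.1 hu.2).1)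
  have main : ∀ u v, P.n ≤ u → u < v → v ≤ P.n + P.m → I u = I v → False := by
    intro u v h1 h2 h3 h4
    obtain ⟨a1, a2, a3, a4, a5, a6, a7⟩ := hI u h1 (by omega)
    obtain ⟨b1, b2, b3, b4, b5, b6, b7⟩ := hI v (by omega) h3
    rw [← h4] at b3 b4 b5
    have o := hone u (by omega)
    have := le_aux hs (u + 1) v h2 (by omega)
    exact hM (fuse hcov hr a2 a1 a3 b3 ⟨a4, a5⟩ ⟨b4, b5⟩ a6 b7 (by omega)
      (by omega : s (u + 1) - 1 ≤ s v) o.1)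
  simp only [Finset.mem_Icc] at hu hv
  rcases Nat.lt_or_gt_of_ne huv with h | h
  · exact main u v hu.1 h hv.2 huv2
  · exact main v u hv.1 h hu.2 huv2.symm

end BMat

/-- **Lemma.** If all the 1-entries of a pattern `P` can be covered by one
row and one column, then `P` is row-bounding. -/
theorem stmt_14 (P : BMat) (r c : ℕ)
    (hcov : ∀ i j, i < P.m → j < P.n → P.entry i j = true → i = r ∨ j = c) :
    RowBounded (Av P) := by
  refine ⟨2 * P.n + P.m, ?_⟩
  intro M hM t ht
  by_cases hdeg : P.m = 0 ∨ P.n = 0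
  · -- degenerate patterns: a critical matrix has no 0-entries
    have hempty : {j | j < M.n ∧ M.entry t j = false ∧
        (j = 0 ∨ M.entry t (j - 1) = true)} = (∅ : Set ℕ) := by
      ext j
      simp only [Set.mem_ofPred_eq, Set.mem_empty_iff_false, iff_false]
      rintro ⟨hj, hz, -⟩
      have hh := hM.2 t j ht hj hz
      apply hh
      rintro ⟨M', g1, g2, g3, -⟩
      have d := dims_le g1
      have e1 : (setOne M t j).m = M.m := rfl
      have e2 : (setOne M t j).n = M.n := rfl
      rw [e1, e2] at d
      omega
    rw [rowRunCount, hempty]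
    simp
  · push Not at hdeg
    have hPm : 0 < P.m := by omega
    have hPn : 0 < P.n := by omega
    obtain ⟨r', hr', hcov'⟩ : ∃ r', r' < P.m ∧
        ∀ i j, i < P.m → j < P.n → P.entry i j = true → i = r' ∨ j = c := by
      by_cases h : r < P.m
      · exact ⟨r, h, hcov⟩
      · refine ⟨0, hPm, fun i j hi hj hij => ?_⟩
        rcases hcov i j hi hj hij with h1 | h1
        · omega
        · exact Or.inr h1
    have hnot : ¬ PartitionContains M P := fun h => hM.1 (minor_of_part hPm hPn h)
    have hcrit : ∀ x, x < M.n → M.entry t x = false →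
        PartitionContains (setOne M t x) P := by
      intro x hx hz
      have := hM.2 t x ht hx hz
      apply part_of_minor
      by_contra hc
      exact this hc
    by_contra hlt
    push Not at hlt
    let p : ℕ → Prop := fun j => j < M.n ∧ M.entry t j = false ∧
      (j = 0 ∨ M.entry t (j - 1) = true)
    have hfin : (Set.ofPred p).Finite := (Set.finite_lt_nat M.n).subset fun j hj => hj.1
    have hcard : 2 * P.n + P.m < hfin.toFinset.card := by
      rw [← Set.ncard_eq_toFinset_card _ hfin]
      exact hlt
    have hc : ∀ u, u ≤ 2 * P.n + P.m → u < hfin.toFinset.card := fun u hu =>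
      lt_of_le_of_lt hu hcard
    refine bound_aux hcov' hr' hnot hcrit (Nat.nth p) ?_ ?_
    · intro u hu
      exact Nat.nth_strictMonoOn hfin (hc u (by omega)) (hc (u + 1) (by omega))
        (Nat.lt_succ_self u)
    · intro u hu
      exact Nat.nth_mem_of_lt_card (p := p) hfin (hc u hu)
end

section
/- If a pattern P ∈ {0,1}^{k×ℓ} avoids D₂ as an interval minor, or avoids D̄₂ as an interval minor, then P is row-bounding. -/
open BMat


namespace BMat

/-- Full cuts of `M` into `k × l` blocks. -/
structure Cuts (k N : ℕ) (r : ℕ → ℕ) : Prop where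
  zero : r 0 = 0
  last : r k = N
  lt : ∀ i j, i < j → j ≤ k → r i < r j

theorem Cuts.le {k N : ℕ} {r : ℕ → ℕ} (h : Cuts k N r) {i j : ℕ} (hij : i ≤ j) (hj : j ≤ k) :
    r i ≤ r j := by
  rcases Nat.eq_or_lt_of_le hij with e | e
  · rw [e]
  · exact (h.lt i j e hj).le

def Blk (P M : BMat) (r c : ℕ → ℕ) (i j : ℕ) : Prop :=
  ∃ a b, r i ≤ a ∧ a < r (i + 1) ∧ c j ≤ b ∧ b < c (j + 1) ∧ M.entry a b = true

def Full (P M : BMat) (r c : ℕ → ℕ) : Prop :=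
  Cuts P.m M.m r ∧ Cuts P.n M.n c ∧
    ∀ i j, i < P.m → j < P.n → P.entry i j = true → Blk P M r c i j

theorem full_refl (M : BMat) : Full M M id id := by
  refine ⟨⟨rfl, rfl, fun i j h _ => h⟩, ⟨rfl, rfl, fun i j h _ => h⟩, ?_⟩
  intro i j _ _ h
  exact ⟨i, j, le_refl _, Nat.lt_succ_self _, le_refl _, Nat.lt_succ_self _, h⟩

theorem Cuts.comp {k l N : ℕ} {r s : ℕ → ℕ} (h : Cuts k l r) (h' : Cuts l N s) :
    Cuts k N (s ∘ r) := by
  refine ⟨by simp [h.zero, h'.zero], by simp [h.last, h'.last], ?_⟩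
  intro i j hij hj
  exact h'.lt _ _ (h.lt i j hij hj) (by rw [← h.last]; exact h.le hj le_rfl)

theorem full_trans {P M N : BMat} {r c s d : ℕ → ℕ} (h : Full P M r c) (h' : Full M N s d) :
    Full P N (s ∘ r) (d ∘ c) := by
  refine ⟨h.1.comp h'.1, h.2.1.comp h'.2.1, ?_⟩
  intro i j hi hj hp
  obtain ⟨a, b, h1, h2, h3, h4, h5⟩ := h.2.2 i j hi hj hp
  have hr := h.1.le (i := i + 1) (j := P.m) hi le_rfl
  have hc := h.2.1.le (i := j + 1) (j := P.n) hj le_rfl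
  rw [h.1.last] at hr
  rw [h.2.1.last] at hc
  obtain ⟨a', b', g1, g2, g3, g4, g5⟩ := h'.2.2 a b (by omega) (by omega) h5
  have e1 := h'.1.le h1 (by omega)
  have e2 := h'.1.le (i := a + 1) h2 hr
  have e3 := h'.2.1.le h3 (by omega)
  have e4 := h'.2.1.le (i := b + 1) h4 hc
  refine ⟨a', b', ?_, ?_, ?_, ?_, g5⟩ <;> simp only [Function.comp] <;> omega

theorem cuts_con {m r : ℕ} (h : r < m) : Cuts m (m + 1) (fun i => if i ≤ r then i else i + 1) := by
  refine ⟨by simp, ?_, ?_⟩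
  · simp [h]
  · intro i j hij hj
    beta_reduce
    split_ifs <;> omega

theorem cuts_id (m : ℕ) : Cuts m m id := ⟨rfl, rfl, fun i j h _ => h⟩

theorem full_con {M M' : BMat} (h : Con M M') : ∃ r c, Full M' M r c := by
  rcases h with ⟨r, h1, h2, h3, h4⟩ | ⟨r, h1, h2, h3, h4⟩
  · refine ⟨fun i => if i ≤ r then i else i + 1, id, ?_, ?_, ?_⟩
    · rw [← h2]; exact cuts_con (by omega)
    · rw [h3]; exact cuts_id _
    · intro i j hi hj hp
      rw [h4 i j hi hj] at hp
      simp only [Blk, id]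
      split_ifs at hp with g1 g2
      · refine ⟨i, j, ?_, ?_, le_rfl, Nat.lt_succ_self _, hp⟩ <;> split_ifs <;> omega
      · subst g2
        rcases Bool.or_eq_true _ _ ▸ hp with hp | hp
        · refine ⟨i, j, ?_, ?_, le_rfl, Nat.lt_succ_self _, hp⟩ <;> split_ifs <;> omega
        · refine ⟨i + 1, j, ?_, ?_, le_rfl, Nat.lt_succ_self _, hp⟩ <;> split_ifs <;> omega
      · refine ⟨i + 1, j, ?_, ?_, le_rfl, Nat.lt_succ_self _, hp⟩ <;> split_ifs <;> omega
  · refine ⟨id, fun i => if i ≤ r then i else i + 1, ?_, ?_, ?_⟩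
    · rw [h3]; exact cuts_id _
    · rw [← h2]; exact cuts_con (by omega)
    · intro i j hi hj hp
      rw [h4 i j hi hj] at hp
      simp only [Blk, id]
      split_ifs at hp with g1 g2
      · refine ⟨i, j, le_rfl, Nat.lt_succ_self _, ?_, ?_, hp⟩ <;> split_ifs <;> omega
      · subst g2
        rcases Bool.or_eq_true _ _ ▸ hp with hp | hp
        · refine ⟨i, j, le_rfl, Nat.lt_succ_self _, ?_, ?_, hp⟩ <;> split_ifs <;> omega
        · refine ⟨i, j + 1, le_rfl, Nat.lt_succ_self _, ?_, ?_, hp⟩ <;> split_ifs <;> omega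
      · refine ⟨i, j + 1, le_rfl, Nat.lt_succ_self _, ?_, ?_, hp⟩ <;> split_ifs <;> omega

theorem full_of_minor {P M : BMat} (h : IntervalMinor P M) : ∃ r c, Full P M r c := by
  obtain ⟨M', h1, h2, h3, h4⟩ := h
  have key : ∃ r c, Full M' M r c := by
    clear h2 h3 h4
    induction h1 with
    | refl => exact ⟨_, _, full_refl _⟩
    | tail _ hc ih =>
      obtain ⟨r, c, h⟩ := ih
      obtain ⟨s, d, h'⟩ := full_con hc
      exact ⟨_, _, full_trans h' h⟩
  obtain ⟨r, c, k1, k2, k3⟩ := key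
  refine ⟨r, c, h2 ▸ k1, h3 ▸ k2, ?_⟩
  intro i j hi hj hp
  exact k3 i j (by omega) (by omega) (h4 i j hi hj hp)

theorem Cuts.gap {k N : ℕ} {r : ℕ → ℕ} (h : Cuts k N r) (hN : N ≠ k) :
    ∃ i, i < k ∧ r i + 2 ≤ r (i + 1) := by
  by_contra hc
  push Not at hc
  have : ∀ i, i ≤ k → r i = i := by
    intro i
    induction i with
    | zero => intro _; exact h.zero
    | succ i ih =>
      intro hi
      have a1 := hc i (by omega)
      have a2 := h.lt i (i + 1) (by omega) hi
      have a3 := ih (by omega)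
      omega
  have := this k le_rfl
  rw [h.last] at this
  exact hN this

theorem Cuts.eq_id {k : ℕ} {r : ℕ → ℕ} (h : Cuts k k r) : ∀ i, i ≤ k → r i = i := by
  have h1 : ∀ i, i ≤ k → i ≤ r i := by
    intro i
    induction i with
    | zero => intro _; exact Nat.zero_le _
    | succ i ih =>
      intro hi
      have a2 := h.lt i (i + 1) (by omega) hi
      have a3 := ih (by omega)
      omega
  have h2 : ∀ d, d ≤ k → r (k - d) ≤ k - d := by
    intro d
    induction d with
    | zero => intro _; simp [h.last]
    | succ d ih =>
      intro hd
      have a2 := h.lt (k - (d + 1)) (k - d) (by omega) (by omega)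
      have a3 := ih (by omega)
      omega
  intro i hi
  have := h2 (k - i) (by omega)
  rw [Nat.sub_sub_self hi] at this
  have := h1 i hi
  omega

theorem Cuts.contract {k N : ℕ} {r : ℕ → ℕ} (h : Cuts k (N + 1) r) {i : ℕ} (hi : i < k)
    (hg : r i + 2 ≤ r (i + 1)) : Cuts k N (fun x => if x ≤ i then r x else r x - 1) := by
  refine ⟨by simp [h.zero], ?_, ?_⟩
  · have := h.last
    beta_reduce
    rw [if_neg (by omega)]; omega
  · intro x y hxy hy
    have a1 := h.lt x y hxy hy
    beta_reduce
    split_ifs with g1 g2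
    · exact a1
    · have a2 := h.le (i := x) (j := i) g1 (by omega)
      have a3 := h.le (i := i + 1) (j := y) (by omega) hy
      omega
    · omega
    · have a3 := h.le (i := i + 1) (j := x) (by omega) (by omega)
      omega

theorem Cuts.contract_mem {k N : ℕ} {r : ℕ → ℕ} (h : Cuts k N r) {i : ℕ} (hi : i < k)
    (hg : r i + 2 ≤ r (i + 1)) {x a : ℕ} (hx : x < k) (h1 : r x ≤ a) (h2 : a < r (x + 1)) :
    (if x ≤ i then r x else r x - 1) ≤ (if a ≤ r i then a else a - 1) ∧
    (if a ≤ r i then a else a - 1) < (if x + 1 ≤ i then r (x + 1) else r (x + 1) - 1) := by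
  rcases lt_trichotomy x i with g | g | g
  · have a2 := h.le (i := x + 1) (j := i) g (by omega)
    rw [if_pos (by omega), if_pos (by omega), if_pos (by omega)]
    omega
  · subst g
    rw [if_pos (le_refl x), if_neg (by omega : ¬ x + 1 ≤ x)]
    split_ifs <;> omega
  · have a2 := h.lt i x g (by omega)
    rw [if_neg (by omega : ¬ x ≤ i), if_neg (by omega : ¬ a ≤ r i), if_neg (by omega : ¬ x + 1 ≤ i)]
    omega

theorem minor_of_full (P : BMat) : ∀ (s : ℕ) (M : BMat), M.m + M.n = s → ∀ r c, Full P M r c →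
    IntervalMinor P M := by
  intro s
  induction s with
  | zero =>
    intro M hM r c h
    have hm : P.m = 0 := by
      by_contra hne
      have := h.1.lt 0 P.m (by omega) le_rfl
      have := h.1.last
      omega
    have hn : P.n = 0 := by
      by_contra hne
      have := h.2.1.lt 0 P.n (by omega) le_rfl
      have := h.2.1.last
      omega
    exact ⟨M, Relation.ReflTransGen.refl, by omega, by omega, fun i j hi => by omega⟩
  | succ s ih =>
    intro M hM r c h
    by_cases e1 : M.m = P.m
    · by_cases e2 : M.n = P.n
      · refine ⟨M, Relation.ReflTransGen.refl, e1, e2, ?_⟩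
        intro i j hi hj hp
        obtain ⟨a, b, h1, h2, h3, h4, h5⟩ := h.2.2 i j hi hj hp
        have c1 := Cuts.eq_id (e1 ▸ h.1)
        have c2 := Cuts.eq_id (e2 ▸ h.2.1)
        rw [c1 i hi.le] at h1
        rw [c1 (i + 1) hi] at h2
        rw [c2 j hj.le] at h3
        rw [c2 (j + 1) hj] at h4
        have : a = i := by omega
        have : b = j := by omega
        subst a b
        exact h5
      · obtain ⟨i, hi, hg⟩ := h.2.1.gap e2
        have hb := h.2.1.le (i := i + 1) hi le_rfl
        rw [h.2.1.last] at hb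
        let M' : BMat := ⟨M.m, M.n - 1, fun x j =>
          if j < c i then M.entry x j
          else if j = c i then (M.entry x (c i) || M.entry x (c i + 1))
          else M.entry x (j + 1)⟩
        have hcon : Con M M' := Or.inr ⟨c i, by omega, by simp only [M']; omega, rfl,
          fun _ _ _ _ => rfl⟩
        have hN : M.n = M'.n + 1 := by simp only [M']; omega
        have hfull : Full P M' r (fun x => if x ≤ i then c x else c x - 1) := by
          refine ⟨h.1, Cuts.contract (hN ▸ h.2.1) hi hg, ?_⟩
          intro x y hx hy hp
          obtain ⟨a, b, h1, h2, h3, h4, h5⟩ := h.2.2 x y hx hy hp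
          have := h.2.1.contract_mem hi hg hy h3 h4
          refine ⟨a, if b ≤ c i then b else b - 1, h1, h2, this.1, this.2, ?_⟩
          simp only [M']
          by_cases g1 : b < c i
          · rw [if_pos g1.le, if_pos g1]; exact h5
          by_cases g2 : b = c i
          · subst g2; simp [h5]
          by_cases g3 : b = c i + 1
          · subst g3; simp [h5]
          · rw [if_neg (by omega : ¬ b ≤ c i), if_neg (by omega : ¬ b - 1 < c i),
              if_neg (by omega : ¬ b - 1 = c i)]
            rw [Nat.sub_add_cancel (by omega)]; exact h5
        obtain ⟨M'', k1, k2⟩ := ih M' (by simp only [M']; omega) _ _ hfull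
        exact ⟨M'', Relation.ReflTransGen.head hcon k1, k2⟩
    · obtain ⟨i, hi, hg⟩ := h.1.gap e1
      have hb := h.1.le (i := i + 1) hi le_rfl
      rw [h.1.last] at hb
      let M' : BMat := ⟨M.m - 1, M.n, fun j x =>
        if j < r i then M.entry j x
        else if j = r i then (M.entry (r i) x || M.entry (r i + 1) x)
        else M.entry (j + 1) x⟩
      have hcon : Con M M' := Or.inl ⟨r i, by omega, by simp only [M']; omega, rfl,
        fun _ _ _ _ => rfl⟩
      have hN : M.m = M'.m + 1 := by simp only [M']; omega
      have hfull : Full P M' (fun x => if x ≤ i then r x else r x - 1) c := by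
        refine ⟨Cuts.contract (hN ▸ h.1) hi hg, h.2.1, ?_⟩
        intro y x hy hx hp
        obtain ⟨b, a, h3, h4, h1, h2, h5⟩ := h.2.2 y x hy hx hp
        have := h.1.contract_mem hi hg hy h3 h4
        refine ⟨if b ≤ r i then b else b - 1, a, this.1, this.2, h1, h2, ?_⟩
        simp only [M']
        by_cases g1 : b < r i
        · rw [if_pos g1.le, if_pos g1]; exact h5
        by_cases g2 : b = r i
        · subst g2; simp [h5]
        by_cases g3 : b = r i + 1
        · subst g3; simp [h5]
        · rw [if_neg (by omega : ¬ b ≤ r i), if_neg (by omega : ¬ b - 1 < r i),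
              if_neg (by omega : ¬ b - 1 = r i)]
          rw [Nat.sub_add_cancel (by omega)]; exact h5
      obtain ⟨M'', k1, k2⟩ := ih M' (by simp only [M']; omega) _ _ hfull
      exact ⟨M'', Relation.ReflTransGen.head hcon k1, k2⟩

theorem minor_iff {P M : BMat} : IntervalMinor P M ↔ ∃ r c, Full P M r c :=
  ⟨full_of_minor, fun ⟨r, c, h⟩ => minor_of_full P _ M rfl r c h⟩

theorem cuts_two {i N : ℕ} (h : i + 1 < N) :
    Cuts 2 N (fun x => if x = 0 then 0 else if x = 1 then i + 1 else N) := by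
  refine ⟨by simp, by simp, ?_⟩
  intro x y hxy hy
  beta_reduce
  split_ifs <;> omega

theorem chain_D {P : BMat} (h : Avoids (D 2) P) {i j i' j' : ℕ} (hi' : i' < P.m)
    (hj' : j' < P.n) (hp : P.entry i j = true) (hp' : P.entry i' j' = true) (h1 : i < i') :
    j' ≤ j := by
  by_contra hc
  apply h
  rw [minor_iff]
  refine ⟨_, _, cuts_two (i := i) (by omega), cuts_two (i := j) (by omega), ?_⟩
  intro x y hx hy hxy
  simp only [D, beq_iff_eq] at hx hy hxy
  subst hxy
  interval_cases x
  · exact ⟨i, j, by simp, by simp, by simp, by simp, hp⟩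
  · exact ⟨i', j', by simp; omega, by simpa using hi', by simp; omega, by simpa using hj', hp'⟩

theorem chain_Dbar {P : BMat} (h : Avoids (Dbar 2) P) {i j i' j' : ℕ} (hi' : i' < P.m)
    (hj : j < P.n) (hp : P.entry i j = true) (hp' : P.entry i' j' = true) (h1 : i < i') :
    j ≤ j' := by
  by_contra hc
  apply h
  rw [minor_iff]
  refine ⟨_, _, cuts_two (i := i) (by omega), cuts_two (i := j') (by omega), ?_⟩
  intro x y hx hy hxy
  simp only [Dbar, beq_iff_eq] at hx hy hxy
  interval_cases x
  · have : y = 1 := by omega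
    subst this
    exact ⟨i, j, by simp, by simp, by simp; omega, by simpa using hj, hp⟩
  · have : y = 0 := by omega
    subst this
    exact ⟨i', j', by simp; omega, by simpa using hi', by simp, by simp, hp'⟩

/-- Data of a critical 0-entry `(r,f)` for the entry `(a,b)` of `P`. -/
def Crit (P M : BMat) (r f a b : ℕ) (R C : ℕ → ℕ) : Prop :=
  a < P.m ∧ b < P.n ∧ P.entry a b = true ∧ Cuts P.m M.m R ∧ Cuts P.n M.n C ∧
  R a ≤ r ∧ r < R (a + 1) ∧ C b ≤ f ∧ f < C (b + 1) ∧
  (∀ u, M.entry r u = true → f ≤ u → C (b + 1) ≤ u) ∧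
  (∀ u, M.entry r u = true → u ≤ f → u < C b) ∧
  ∀ i j, i < P.m → j < P.n → i ≠ a → P.entry i j = true → Blk P M R C i j

theorem Cuts.uniq {k N : ℕ} {r : ℕ → ℕ} (h : Cuts k N r) {i j x : ℕ} (hi : i < k) (hj : j < k)
    (h1 : r i ≤ x) (h2 : x < r (i + 1)) (h3 : r j ≤ x) (h4 : x < r (j + 1)) : i = j := by
  rcases lt_trichotomy i j with g | g | g
  · have := h.le (i := i + 1) (j := j) g (by omega)
    omega
  · exact g
  · have := h.le (i := j + 1) (j := i) g (by omega)
    omega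

theorem exists_crit {P M : BMat} (hM : CriticalFor (Av P) M) {r f : ℕ} (hr : r < M.m)
    (hf : f < M.n) (h0 : M.entry r f = false) : ∃ a b R C, Crit P M r f a b R C := by
  have h1 := hM.2 r f hr hf h0
  simp only [Av, Avoids, Set.mem_setOf_eq, not_not] at h1
  obtain ⟨R, C, hR, hC, hB⟩ := full_of_minor h1
  change Cuts P.m M.m R at hR
  change Cuts P.n M.n C at hC
  have h2 : ∃ a b, a < P.m ∧ b < P.n ∧ P.entry a b = true ∧ ¬ Blk P M R C a b := by
    by_contra hc
    push Not at hc
    exact hM.1 (minor_iff.2 ⟨R, C, hR, hC, hc⟩)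
  obtain ⟨a, b, ha, hb, hp, hn⟩ := h2
  have key : ∀ x y, Blk P (setOne M r f) R C x y → ¬ Blk P M R C x y →
      R x ≤ r ∧ r < R (x + 1) ∧ C y ≤ f ∧ f < C (y + 1) := by
    rintro x y ⟨u, v, g1, g2, g3, g4, g5⟩ hnn
    by_cases he : u = r ∧ v = f
    · obtain ⟨rfl, rfl⟩ := he
      exact ⟨g1, g2, g3, g4⟩
    · simp only [setOne, if_neg he] at g5
      exact absurd ⟨u, v, g1, g2, g3, g4, g5⟩ hnn
  obtain ⟨k1, k2, k3, k4⟩ := key a b (hB a b ha hb hp) hn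
  refine ⟨a, b, R, C, ha, hb, hp, hR, hC, k1, k2, k3, k4, ?_, ?_, ?_⟩
  · intro u hu hfu
    by_contra hc
    exact hn ⟨r, u, k1, k2, by omega, by omega, hu⟩
  · intro u hu hfu
    by_contra hc
    exact hn ⟨r, u, k1, k2, by omega, by omega, hu⟩
  · intro i j hi hj hne hp'
    by_contra hnn
    obtain ⟨l1, l2, -, -⟩ := key i j (hB i j hi hj hp') hnn
    exact hne (hR.uniq hi ha l1 l2 k1 k2)

theorem Cuts.mix {k N : ℕ} {r s : ℕ → ℕ} (h : Cuts k N r) (h' : Cuts k N s) {a x : ℕ} (ha : a < k)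
    (h1 : r a ≤ x) (h2 : x < s (a + 1)) : Cuts k N (fun i => if i ≤ a then r i else s i) := by
  refine ⟨by simp [h.zero], ?_, ?_⟩
  · beta_reduce
    rw [if_neg (by omega)]; exact h'.last
  · intro i j hij hj
    beta_reduce
    split_ifs with g1 g2
    · exact h.lt i j hij hj
    · have := h.le (i := i) (j := a) g1 (by omega)
      have := h'.le (i := a + 1) (j := j) (by omega) hj
      omega
    · omega
    · exact h'.lt i j hij hj

/-- The column cuts of the combined partition. -/
theorem exists_cols {n N : ℕ} {C E : ℕ → ℕ} (hC : Cuts n N C) (hE : Cuts n N E) {p b q : ℕ}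
    (hpb : p ≤ b) (hbq : b ≤ q) (hq : q < n) (u : ℕ → ℕ)
    (hu : ∀ i j, i < j → j < n → u i < u j)
    (hCu : ∀ i, i < n → C (b + 1) ≤ u i) (hEu : ∀ i, i < n → u i < E b) :
    ∃ c, Cuts n N c ∧ (∀ j, j ≤ p → c j ≤ C j ∧ C (j + 1) ≤ c (j + 1)) ∧
      (∀ j, q ≤ j → j < n → c j ≤ E j ∧ E (j + 1) ≤ c (j + 1)) ∧
      (∀ j, p ≤ j → j ≤ q → c j ≤ u j ∧ u j < c (j + 1)) := by
  have C1 : ∀ i, i ≤ b + 1 → ∀ j, j < n → C i ≤ u j := fun i hi j hj =>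
    (hC.le hi (by omega)).trans (hCu j hj)
  have E1 : ∀ i, b ≤ i → i ≤ n → ∀ j, j < n → u j < E i := fun i hi hin j hj =>
    (hEu j hj).trans_le (hE.le hi hin)
  have C2 : ∀ i, i ≤ b → ∀ j, j < n → C i < u j := fun i hi j hj =>
    (hC.lt i (b + 1) (by omega) (by omega)).trans_le (hCu j hj)
  refine ⟨fun j => if j ≤ p then C j else if j ≤ q then u j else E j, ⟨?_, ?_, ?_⟩, ?_, ?_, ?_⟩
  · simp [hC.zero]
  · beta_reduce
    rw [if_neg (by omega), if_neg (by omega)]; exact hE.last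
  · intro i j hij hj
    beta_reduce
    split_ifs with g1 g2 g3 g4 g5 g6
    · exact hC.lt i j hij hj
    · exact C2 i (by omega) j (by omega)
    · exact (C2 i (by omega) 0 (by omega)).trans (E1 j (by omega) hj 0 (by omega))
    all_goals first
      | omega
      | exact hu i j hij (by omega)
      | exact E1 j (by omega) hj i (by omega)
      | exact hE.lt i j hij hj
  · intro j hj
    beta_reduce
    rw [if_pos hj]
    refine ⟨le_rfl, ?_⟩
    split_ifs with g1 g2
    · exact le_rfl
    · exact C1 _ (by omega) _ (by omega)
    · exact (C1 _ (by omega) 0 (by omega)).trans (E1 (j + 1) (by omega) (by omega) 0 (by omega)).le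
  · intro j hj hjn
    beta_reduce
    rw [if_neg (by omega : ¬ j + 1 ≤ p), if_neg (by omega : ¬ j + 1 ≤ q)]
    refine ⟨?_, le_rfl⟩
    split_ifs with g1 g2
    · exact (C1 j (by omega) 0 (by omega)).trans (E1 j (by omega) (by omega) 0 (by omega)).le
    · exact (E1 j (by omega) (by omega) j (by omega)).le
    · exact le_rfl
  · intro j hj hjq
    beta_reduce
    constructor
    · split_ifs with g1
      · exact C1 j (by omega) j (by omega)
      · exact le_rfl
    · rw [if_neg (by omega : ¬ j + 1 ≤ p)]
      split_ifs with g1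
      · exact hu j (j + 1) (by omega) (by omega)
      · exact E1 (j + 1) (by omega) (by omega) j (by omega)

theorem Blk.mono {P M : BMat} {r c r' c' : ℕ → ℕ} {i j : ℕ} (h : Blk P M r c i j)
    (h1 : r' i ≤ r i) (h2 : r (i + 1) ≤ r' (i + 1)) (h3 : c' j ≤ c j)
    (h4 : c (j + 1) ≤ c' (j + 1)) : Blk P M r' c' i j := by
  obtain ⟨a, b, g1, g2, g3, g4, g5⟩ := h
  exact ⟨a, b, by omega, by omega, by omega, by omega, g5⟩

/-- Two far apart critical entries for the same entry of `P` yield a copy of `P`. -/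
theorem combine {P M : BMat} (h : Avoids (D 2) P ∨ Avoids (Dbar 2) P) {r f g a b : ℕ}
    {R C S E : ℕ → ℕ} (hf : Crit P M r f a b R C) (hg : Crit P M r g a b S E) (u : ℕ → ℕ)
    (hu : ∀ i j, i < j → j < P.n → u i < u j)
    (hu1 : ∀ i, i < P.n → M.entry r (u i) = true)
    (hfu : ∀ i, i < P.n → f ≤ u i) (hgu : ∀ i, i < P.n → u i ≤ g) : IntervalMinor P M := by
  obtain ⟨ha, hb, hp, hR, hC, k1, k2, -, -, k5, -, k7⟩ := hf
  obtain ⟨-, -, -, hS, hE, l1, l2, -, -, -, l6, l7⟩ := hg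
  let T := (Finset.range P.n).filter (fun j => P.entry a j = true)
  have hT : ∀ j, j ∈ T ↔ j < P.n ∧ P.entry a j = true := by intro j; simp [T]
  have hTn : T.Nonempty := ⟨b, (hT b).2 ⟨hb, hp⟩⟩
  obtain ⟨p, hpT, hpmin⟩ := T.exists_min_image id hTn
  obtain ⟨q, hqT, hqmax⟩ := T.exists_max_image id hTn
  have hbT : b ∈ T := (hT b).2 ⟨hb, hp⟩
  rw [hT] at hpT hqT
  obtain ⟨c, hc, c1, c2, c3⟩ := exists_cols hC hE (hpmin b hbT) (hqmax b hbT) hqT.1 u hu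
    (fun i hi => k5 _ (hu1 i hi) (hfu i hi)) (fun i hi => l6 _ (hu1 i hi) (hgu i hi))
  rw [minor_iff]
  rcases h with h | h
  · refine ⟨fun i => if i ≤ a then S i else R i, c, hS.mix hR ha l1 k2, hc, ?_⟩
    intro i j hi hj hij
    rcases lt_trichotomy i a with e | e | e
    · have hqj := chain_D h ha hqT.1 hij hqT.2 e
      refine (l7 i j hi hj (by omega) hij).mono ?_ ?_ (c2 j hqj hj).1 (c2 j hqj hj).2
      · simp [e.le]
      · simp [e]
    · subst e
      have hjT := (hT j).2 ⟨hj, hij⟩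
      have := c3 j (hpmin j hjT) (hqmax j hjT)
      exact ⟨r, u j, by simpa using l1, by simpa using k2, this.1, this.2, hu1 j hj⟩
    · have hpj := chain_D h hi hj hpT.2 hij e
      refine (k7 i j hi hj (by omega) hij).mono ?_ ?_ (c1 j hpj).1 (c1 j hpj).2
      · beta_reduce; rw [if_neg (by omega)]
      · beta_reduce; rw [if_neg (by omega)]
  · refine ⟨fun i => if i ≤ a then R i else S i, c, hR.mix hS ha k1 l2, hc, ?_⟩
    intro i j hi hj hij
    rcases lt_trichotomy i a with e | e | e
    · have hpj := chain_Dbar h ha hj hij hpT.2 e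
      refine (k7 i j hi hj (by omega) hij).mono ?_ ?_ (c1 j hpj).1 (c1 j hpj).2
      · simp [e.le]
      · simp [e]
    · subst e
      have hjT := (hT j).2 ⟨hj, hij⟩
      have := c3 j (hpmin j hjT) (hqmax j hjT)
      exact ⟨r, u j, by simpa using k1, by simpa using l2, this.1, this.2, hu1 j hj⟩
    · have hqj := chain_Dbar h hi hqT.1 hqT.2 hij e
      refine (l7 i j hi hj (by omega) hij).mono ?_ ?_ (c2 j hqj hj).1 (c2 j hqj hj).2
      · beta_reduce; rw [if_neg (by omega)]
      · beta_reduce; rw [if_neg (by omega)]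

end BMat

/-- **Lemma.** A pattern avoiding `D₂` or `D̄₂` as an interval minor is
row-bounding. -/
theorem stmt_15 (P : BMat) (h : Avoids (D 2) P ∨ Avoids (Dbar 2) P) :
    RowBounded (Av P) := by
  classical
  refine ⟨P.m * P.n * P.n, ?_⟩
  intro M hM r hr
  by_contra hlt
  rw [not_le] at hlt
  let A : Finset ℕ := (Finset.range M.n).filter
    (fun j => M.entry r j = false ∧ (j = 0 ∨ M.entry r (j - 1) = true))
  have hA : rowRunCount M r = A.card := by
    rw [rowRunCount, ← Set.ncard_coe_finset]
    congr 1
    ext j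
    simp [A]
  have hmem : ∀ j, j ∈ A → j < M.n ∧ M.entry r j = false ∧ (j = 0 ∨ M.entry r (j - 1) = true) := by
    intro j hj
    simpa [A] using hj
  rw [hA] at hlt
  have hex : ∀ j, ∃ e : ℕ × ℕ, j ∈ A → ∃ R C, Crit P M r j e.1 e.2 R C := by
    intro j
    by_cases hj : j ∈ A
    · obtain ⟨a, b, R, C, h'⟩ := exists_crit hM hr (hmem j hj).1 (hmem j hj).2.1
      exact ⟨(a, b), fun _ => ⟨R, C, h'⟩⟩
    · exact ⟨(0, 0), fun h => absurd h hj⟩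
  choose e he using hex
  obtain ⟨y, -, hy⟩ := Finset.exists_lt_card_fiber_of_mul_lt_card_of_maps_to (s := A)
    (t := Finset.range P.m ×ˢ Finset.range P.n) (f := e) (n := P.n)
    (by
      intro j hj
      obtain ⟨R, C, h'⟩ := he j hj
      simp only [Finset.mem_product, Finset.mem_range]
      exact ⟨h'.1, h'.2.1⟩)
    (by simpa using hlt)
  obtain ⟨B, hBs, hBc⟩ := Finset.exists_subset_card_eq (Nat.succ_le_of_lt hy)
  let F := B.orderEmbOfFin hBc
  have hF : ∀ i, F i ∈ A ∧ e (F i) = y := by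
    intro i
    have := hBs (B.orderEmbOfFin_mem hBc i)
    simpa [F] using this
  have hFlt : ∀ i j, i < j → F i < F j := fun i j hij => F.strictMono hij
  let v : ℕ → ℕ := fun i => if hi : i < P.n + 1 then F ⟨i, hi⟩ else 0
  have hv : ∀ i, i < P.n + 1 → v i ∈ A ∧ e (v i) = y := by
    intro i hi
    simp only [v, dif_pos hi]
    exact hF _
  have hvlt : ∀ i j, i < j → j < P.n + 1 → v i < v j := by
    intro i j hij hj
    simp only [v, dif_pos hj, dif_pos (hij.trans hj)]
    exact hFlt _ _ hij
  obtain ⟨R, C, h1⟩ := he (v 0) (hv 0 (by omega)).1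
  obtain ⟨S, E, h2⟩ := he (v P.n) (hv P.n (by omega)).1
  rw [(hv 0 (by omega)).2] at h1
  rw [(hv P.n (by omega)).2] at h2
  apply hM.1
  refine combine h h1 h2 (fun i => v (i + 1) - 1) ?_ ?_ ?_ ?_
  · intro i j hij hj
    have a1 := hvlt (i + 1) (j + 1) (by omega) (by omega)
    have a2 := hvlt 0 (i + 1) (by omega) (by omega)
    beta_reduce
    omega
  · intro i hi
    have a2 := hvlt 0 (i + 1) (by omega) (by omega)
    rcases (hmem _ (hv (i + 1) (by omega)).1).2.2 with h0 | h0
    · omega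
    · exact h0
  · intro i hi
    have a2 := hvlt 0 (i + 1) (by omega) (by omega)
    beta_reduce
    omega
  · intro i hi
    beta_reduce
    rcases Nat.eq_or_lt_of_le (Nat.succ_le_of_lt hi) with g | g
    · have : i + 1 = P.n := g
      rw [this]; omega
    · have a1 := hvlt (i + 1) P.n g (by omega)
      omega
end

section
/- Let C₁ and C₂ be row-bounded minor-closed classes of binary matrices, with row-complexities K₁ and K₂ respectively. Then the class C₁ ∪ C₂ is row-bounded with row-complexity at most max{K₁, K₂}, and the class C₁ ∩ C₂ is row-bounded with row-complexity at most K₁ + K₂. -/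
open BMat

theorem exists_critical_ext (C : Set BMat) (k : ℕ) : ∀ M ∈ C,
    ((Finset.range M.m ×ˢ Finset.range M.n).filter
      (fun p => M.entry p.1 p.2 = false)).card ≤ k →
    ∃ M', CriticalFor C M' ∧ M'.m = M.m ∧ M'.n = M.n ∧
      ∀ i j, M.entry i j = true → M'.entry i j = true := by
  induction k with
  | zero =>
    intro M hM hk
    refine ⟨M, ⟨hM, ?_⟩, rfl, rfl, fun _ _ h => h⟩
    intro i j hi hj he
    have h0 := Finset.card_eq_zero.mp (Nat.le_zero.mp hk)
    have : (i, j) ∈ (Finset.range M.m ×ˢ Finset.range M.n).filter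
      (fun p => M.entry p.1 p.2 = false) := by simp [hi, hj, he]
    rw [h0] at this
    simp at this
  | succ k ih =>
    intro M hM hk
    by_cases hc : CriticalFor C M
    · exact ⟨M, hc, rfl, rfl, fun _ _ h => h⟩
    · have : ∃ i j, i < M.m ∧ j < M.n ∧ M.entry i j = false ∧ setOne M i j ∈ C := by
        by_contra hn
        exact hc ⟨hM, fun i j hi hj he hs => hn ⟨i, j, hi, hj, he, hs⟩⟩
      obtain ⟨i, j, hi, hj, he, hs⟩ := this
      obtain ⟨M', h1, h2, h3, h4⟩ := ih (setOne M i j) hs (by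
        refine Nat.le_of_lt_succ (lt_of_lt_of_le (Finset.card_lt_card ?_) hk)
        rw [Finset.ssubset_iff_of_subset]
        · exact ⟨(i, j), by simp [hi, hj, he], by simp [setOne]⟩
        · rintro ⟨a, b⟩ h
          rw [Finset.mem_filter] at h ⊢
          refine ⟨h.1, ?_⟩
          have h' := h.2
          simp only [setOne] at h'
          split_ifs at h'
          exact h')
      refine ⟨M', h1, h2, h3, fun a b hab => h4 a b ?_⟩
      simp [setOne, hab]

theorem dominated_mem {C : Set BMat} (hC : MinorClosed C) {M P : BMat} (hM : M ∈ C)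
    (hm : M.m = P.m) (hn : M.n = P.n)
    (h : ∀ i j, P.entry i j = true → M.entry i j = true) : P ∈ C :=
  hC M hM P ⟨M, Relation.ReflTransGen.refl, hm, hn, fun i j _ _ => h i j⟩

/-- **Proposition.** If `C₁` and `C₂` are minor-closed classes whose
row-complexities are bounded by `K₁` and `K₂` respectively, then `C₁ ∪ C₂`
has row-complexity at most `max K₁ K₂` and `C₁ ∩ C₂` has row-complexity at
most `K₁ + K₂`. -/
theorem stmt_17 (C₁ C₂ : Set BMat) (h₁ : MinorClosed C₁) (h₂ : MinorClosed C₂)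
    (K₁ K₂ : ℕ)
    (hb₁ : ∀ M, CriticalFor C₁ M → ∀ r, r < M.m → rowRunCount M r ≤ K₁)
    (hb₂ : ∀ M, CriticalFor C₂ M → ∀ r, r < M.m → rowRunCount M r ≤ K₂) :
    (∀ M, CriticalFor (C₁ ∪ C₂) M → ∀ r, r < M.m →
        rowRunCount M r ≤ max K₁ K₂) ∧
    (∀ M, CriticalFor (C₁ ∩ C₂) M → ∀ r, r < M.m →
        rowRunCount M r ≤ K₁ + K₂) := by
  refine ⟨?_, ?_⟩
  · rintro M ⟨hM, hc⟩ r hr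
    rcases hM with hM | hM
    · exact (hb₁ M ⟨hM, fun i j hi hj he hs => hc i j hi hj he (Or.inl hs)⟩ r hr).trans
        (le_max_left _ _)
    · exact (hb₂ M ⟨hM, fun i j hi hj he hs => hc i j hi hj he (Or.inr hs)⟩ r hr).trans
        (le_max_right _ _)
  · rintro M ⟨⟨hM1, hM2⟩, hc⟩ r hr
    obtain ⟨A, hA, hAm, hAn, hAd⟩ := exists_critical_ext C₁ _ M hM1 le_rfl
    obtain ⟨B, hB, hBm, hBn, hBd⟩ := exists_critical_ext C₂ _ M hM2 le_rfl
    refine le_trans ?_ (Nat.add_le_add (hb₁ A hA r (hAm ▸ hr)) (hb₂ B hB r (hBm ▸ hr)))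
    unfold rowRunCount
    refine le_trans (Set.ncard_le_ncard ?_ ?_) (Set.ncard_union_le _ _)
    · rintro j ⟨hj, he, hs⟩
      by_cases hAj : A.entry r j = false
      · exact Or.inl ⟨hAn ▸ hj, hAj, hs.imp id (hAd _ _)⟩
      by_cases hBj : B.entry r j = false
      · exact Or.inr ⟨hBn ▸ hj, hBj, hs.imp id (hBd _ _)⟩
      exfalso
      rw [Bool.not_eq_false] at hAj hBj
      refine hc r j hr hj he ⟨dominated_mem h₁ hA.1 hAm hAn ?_,
        dominated_mem h₂ hB.1 hBm hBn ?_⟩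
      · intro a b hab
        by_cases h : a = r ∧ b = j
        · rw [h.1, h.2]; exact hAj
        · simp only [setOne, if_neg h] at hab
          exact hAd a b hab
      · intro a b hab
        by_cases h : a = r ∧ b = j
        · rw [h.1, h.2]; exact hBj
        · simp only [setOne, if_neg h] at hab
          exact hBd a b hab
    · exact ((Set.finite_lt_nat A.n).subset fun j hj => hj.1).union
        ((Set.finite_lt_nat B.n).subset fun j hj => hj.1)
end
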